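/- arXiv:1403.2457 — 2 statements merged into one kernel-verified Lean document; each statement's English description precedes it below -/
import Mathlib

section
/- Let T be an invertible strong mixing measure-preserving transformation of a Lebesgue probability space (X, S, μ) and let C ⊆ S be a family of measurable sets with H_μ(C) > 0. Then there exists a dense G_δ set G ⊂ Φ such that for each φ ∈ G, letting T_φ = φ^{-1} ∘ T ∘ φ, one has limsup_{n→∞} sup_{C ∈ C} |μ(C ∩ T_φ^{-n} C) − μ(C)²| > 0. -/
open MeasureTheory Filter

/-- Entropy (base 2) of the join of the sets `C 0, …, C (n-1)`: the cells of the join are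
indexed by sign patterns `s : Fin n → Bool`; cells of measure zero contribute `0`. -/
noncomputable def joinEntropy {X : Type*} [MeasurableSpace X] (μ : Measure X)
    {n : ℕ} (C : Fin n → Set X) : ℝ :=
  ∑ s : Fin n → Bool,
    -((μ (⋂ i, if s i then C i else (C i)ᶜ)).toReal *
      Real.logb 2 (μ (⋂ i, if s i then C i else (C i)ᶜ)).toReal)

/-- Entropy of a family `𝒞` of measurable sets: the supremum over all sequences of sets
from `𝒞` of `liminf (1/n) H_μ(⋁_{i<n} C_i)`. -/
noncomputable def famEntropy {X : Type*} [MeasurableSpace X] (μ : Measure X)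
    (𝒞 : Set (Set X)) : ℝ :=
  ⨆ S : {f : ℕ → Set X // ∀ i, f i ∈ 𝒞},
    Filter.liminf (fun n : ℕ => joinEntropy μ (fun i : Fin n => S.1 i) / n) Filter.atTop

/-- The mean deviation `∫ |(1/n) ∑_{i<n} 1_C(T^i x) − μ(C)| dμ` of the Birkhoff average. -/
noncomputable def birkDev {X : Type*} [MeasurableSpace X] (μ : Measure X)
    (T : X → X) (C : Set X) (n : ℕ) : ℝ :=
  ∫ x, |(∑ i ∈ Finset.range n, C.indicator (fun _ => (1 : ℝ)) (T^[i] x)) / n - (μ C).toReal| ∂μ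

/-- The invertible measure preserving transformations of `(X, 𝒮, μ)` (representatives of
the equivalence classes mod 0). -/
def MPE {X : Type*} [MeasurableSpace X] (μ : Measure X) : Type _ :=
  {e : X ≃ᵐ X // MeasurePreserving e μ μ}

/-- The weak topology on the invertible measure preserving transformations:
`φ_r → φ` iff `μ (φ_r A ∆ φ A) → 0` for every measurable set `A`.  It is realized as the
topology induced by the maps `φ ↦ 1_{φ A} ∈ L¹(μ)` for measurable `A` (note that
`φ A = φ.symm ⁻¹' A`, and `‖1_{φ' A} - 1_{φ A}‖₁ = μ (φ' A ∆ φ A)`). -/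
noncomputable instance MPE.topologicalSpace {X : Type*} [MeasurableSpace X]
    {μ : Measure X} [IsFiniteMeasure μ] : TopologicalSpace (MPE μ) :=
  TopologicalSpace.induced
    (fun φ : MPE μ => fun A : {A : Set X // MeasurableSet A} =>
      (indicatorConstLp 1 (A.2.preimage φ.1.symm.measurable) (measure_ne_top μ _)
        (1 : ℝ) : Lp ℝ 1 μ))
    inferInstance

/-- The conjugate transformation `T_φ = φ⁻¹ ∘ T ∘ φ`. -/
def MPE.conj {X : Type*} [MeasurableSpace X] {μ : Measure X}
    (T : X ≃ᵐ X) (φ : MPE μ) : X → X :=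
  fun x => φ.1.symm (T (φ.1 x))


section part1

lemma aux_gibbs (P Q : ℝ) (hP : 0 ≤ P) (hQ : 0 < Q) :
    -(P * Real.log P) ≤ -(P * Real.log Q) + Q - P := by
  rcases hP.eq_or_lt with h | h
  · subst h; simp; exact hQ.le
  · have h1 : Real.log (Q / P) ≤ Q / P - 1 := Real.log_le_sub_one_of_pos (by positivity)
    rw [Real.log_div hQ.ne' h.ne'] at h1
    have h2 : P * (Real.log Q - Real.log P) ≤ P * (Q / P - 1) :=
      mul_le_mul_of_nonneg_left h1 hP
    have h3 : P * (Q / P - 1) = Q - P := by field_simp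
    nlinarith

open Classical in
lemma aux_joinEntropy_le {X : Type*} [MeasurableSpace X] (μ : Measure X) [IsProbabilityMeasure μ]
    {κ : Type*} [Fintype κ] (l : X → κ) (hl : ∀ J : Set κ, MeasurableSet (l ⁻¹' J))
    {n : ℕ} (C : Fin n → Set X) (hC : ∀ i, MeasurableSet (C i)) (J : Fin n → Set κ)
    (ρ ε : ℝ) (h0 : 0 < ε) (h1 : ε < 1)
    (hJ : ∀ i, μ.real (symmDiff (C i) (l ⁻¹' J i)) ≤ ρ) :
    joinEntropy μ C * Real.log 2 ≤
      Real.log (Fintype.card κ) + n * (-Real.log (1 - ε)) + n * (ρ * (-Real.log ε)) := by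
  have hX : Nonempty X := by
    by_contra h
    rw [not_nonempty_iff] at h
    have := measure_univ (μ := μ)
    rw [Set.univ_eq_empty_iff.2 h] at this
    simp at this
  have hκ : Nonempty κ := hX.map l
  have hcard : (0 : ℝ) < Fintype.card κ := by exact_mod_cast Fintype.card_pos
  let pat : X → Fin n → Bool := fun x i => decide (x ∈ C i)
  have hpat : Measurable pat := by
    refine measurable_pi_lambda _ fun i => ?_
    refine measurable_to_bool ?_
    have : (fun x => pat x i) ⁻¹' {true} = C i := by ext x; simp [pat]
    rw [this]; exact hC i
  have hcell : ∀ s : Fin n → Bool, (⋂ i, if s i then C i else (C i)ᶜ) = pat ⁻¹' {s} := by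
    intro s
    ext x
    simp only [Set.mem_iInter, Set.mem_preimage, Set.mem_singleton_iff, funext_iff, pat]
    refine forall_congr' fun i => ?_
    cases s i <;> simp
  let P : (Fin n → Bool) → ℝ := fun s => μ.real (pat ⁻¹' {s})
  let q : κ → Fin n → Bool → ℝ := fun a i b => if (b = true ↔ a ∈ J i) then 1 - ε else ε
  have hq : ∀ a i b, 0 < q a i b := by
    intro a i b; simp only [q]; split_ifs <;> linarith
  let Q : (Fin n → Bool) → ℝ := fun s => (Fintype.card κ : ℝ)⁻¹ * ∑ a, ∏ i, q a i (s i)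
  have hQpos : ∀ s, 0 < Q s := by
    intro s
    refine mul_pos (inv_pos.2 hcard) (Finset.sum_pos (fun a _ => Finset.prod_pos fun i _ => hq _ _ _) ?_)
    exact Finset.univ_nonempty
  have hQsum : ∑ s, Q s = 1 := by
    simp only [Q]
    rw [← Finset.mul_sum, Finset.sum_comm]
    have : ∀ a, ∑ s : Fin n → Bool, ∏ i, q a i (s i) = 1 := by
      intro a
      have := Finset.prod_univ_sum (fun _ : Fin n => (Finset.univ : Finset Bool)) (fun i b => q a i b)
      rw [Fintype.piFinset_univ] at this
      rw [← this]
      refine Finset.prod_eq_one fun i _ => ?_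
      simp only [Fintype.sum_bool, q]
      by_cases h : a ∈ J i <;> simp [h]
    simp only [this]
    simp [hcard.ne']
  have hint : ∀ f : (Fin n → Bool) → ℝ, ∑ s, P s * f s = ∫ x, f (pat x) ∂μ := by
    intro f
    have h1 : ∫ x, f (pat x) ∂μ = ∫ s, f s ∂(μ.map pat) := by
      rw [integral_map hpat.aemeasurable]
      exact (measurable_of_finite f).aestronglyMeasurable
    have hp : IsProbabilityMeasure (μ.map pat) := Measure.isProbabilityMeasure_map hpat.aemeasurable
    rw [h1, integral_fintype (Integrable.of_finite)]
    refine Finset.sum_congr rfl fun s _ => ?_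
    rw [map_measureReal_apply hpat (MeasurableSet.singleton s)]
    simp [P]
  have hPsum : ∑ s, P s = 1 := by
    have := hint (fun _ => 1)
    simpa using this
  have e1 : joinEntropy μ C * Real.log 2 = ∑ s, -(P s * Real.log (P s)) := by
    unfold joinEntropy
    rw [Finset.sum_mul]
    refine Finset.sum_congr rfl fun s _ => ?_
    rw [hcell]
    have : Real.log 2 ≠ 0 := by positivity
    simp only [Real.logb, P, Measure.real]
    field_simp
  have e2 : ∑ s, -(P s * Real.log (P s)) ≤ ∑ s, P s * (- Real.log (Q s)) := by
    calc ∑ s, -(P s * Real.log (P s)) ≤ ∑ s, (P s * (- Real.log (Q s)) + Q s - P s) := by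
          refine Finset.sum_le_sum fun s _ => ?_
          have := aux_gibbs (P s) (Q s) measureReal_nonneg (hQpos s)
          linarith
      _ = _ := by
          rw [Finset.sum_sub_distrib, Finset.sum_add_distrib, hQsum, hPsum]; ring
  rw [e1]
  refine e2.trans ?_
  rw [hint]
  let D : Fin n → Set X := fun i => symmDiff (C i) (l ⁻¹' J i)
  have hD : ∀ i, MeasurableSet (D i) := fun i => (hC i).symmDiff (hl _)
  have hlogε : 0 ≤ - Real.log ε := by
    have := Real.log_nonpos h0.le h1.le; linarith
  have hlogε' : 0 ≤ - Real.log (1 - ε) := by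
    have := Real.log_nonpos (x := 1 - ε) (by linarith) (by linarith); linarith
  have pt : ∀ x, - Real.log (Q (pat x)) ≤ Real.log (Fintype.card κ) +
      ∑ i, (- Real.log (1 - ε) + (D i).indicator (fun _ => - Real.log ε) x) := by
    intro x
    have hge : (Fintype.card κ : ℝ)⁻¹ * ∏ i, q (l x) i (pat x i) ≤ Q (pat x) := by
      refine mul_le_mul_of_nonneg_left ?_ (inv_pos.2 hcard).le
      exact Finset.single_le_sum (f := fun a => ∏ i, q a i (pat x i))
        (fun a _ => Finset.prod_nonneg fun i _ => (hq _ _ _).le) (Finset.mem_univ (l x))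
    have hpr : 0 < ∏ i, q (l x) i (pat x i) := Finset.prod_pos fun i _ => hq _ _ _
    have hlog := Real.log_le_log (mul_pos (inv_pos.2 hcard) hpr) hge
    rw [Real.log_mul (inv_pos.2 hcard).ne' hpr.ne', Real.log_inv,
      Real.log_prod (fun i _ => (hq _ _ _).ne')] at hlog
    have : -∑ i, Real.log (q (l x) i (pat x i)) ≤
        ∑ i, (- Real.log (1 - ε) + (D i).indicator (fun _ => - Real.log ε) x) := by
      rw [← Finset.sum_neg_distrib]
      refine Finset.sum_le_sum fun i _ => ?_
      simp only [q, pat, D, Set.indicator, Set.mem_symmDiff, Set.mem_preimage, decide_eq_true_eq]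
      by_cases h1 : x ∈ C i <;> by_cases h2 : l x ∈ J i <;> simp [h1, h2] <;> linarith
    linarith
  have hintD : ∀ i, Integrable (fun x => (D i).indicator (fun _ => - Real.log ε) x) μ :=
    fun i => (integrable_const _).indicator (hD i)
  have hi2 : ∀ i, Integrable (fun x => - Real.log (1 - ε) + (D i).indicator (fun _ => - Real.log ε) x) μ :=
    fun i => (integrable_const _).add (hintD i)
  calc ∫ x, - Real.log (Q (pat x)) ∂μ ≤ ∫ x, (Real.log (Fintype.card κ) +
      ∑ i, (- Real.log (1 - ε) + (D i).indicator (fun _ => - Real.log ε) x)) ∂μ := by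
        refine integral_mono ?_ ?_ pt
        · have hp : IsProbabilityMeasure (μ.map pat) :=
            Measure.isProbabilityMeasure_map hpat.aemeasurable
          exact (Integrable.of_finite (μ := μ.map pat)
            (f := fun s => - Real.log (Q s))).comp_measurable hpat
        · exact (integrable_const _).add (integrable_finsetSum _ fun i _ => hi2 i)
    _ = Real.log (Fintype.card κ) + ∑ i, (- Real.log (1 - ε) + μ.real (D i) * (- Real.log ε)) := by
        rw [integral_add (integrable_const _) (integrable_finsetSum _ fun i _ => hi2 i),
          integral_finsetSum _ fun i _ => hi2 i]
        simp only [integral_const, probReal_univ, smul_eq_mul, one_mul]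
        congr 1
        refine Finset.sum_congr rfl fun i _ => ?_
        rw [integral_add (integrable_const _) (hintD i), integral_indicator_const _ (hD i)]
        simp
    _ ≤ Real.log (Fintype.card κ) + ∑ i : Fin n, (- Real.log (1 - ε) + ρ * (- Real.log ε)) := by
        gcongr with i
        exact hJ i
    _ = _ := by
        simp; ring

/-- positive entropy: for every finite labelling some member of the family is badly approximated -/
lemma aux_entropy {X : Type*} [MeasurableSpace X] (μ : Measure X) [IsProbabilityMeasure μ]
    (𝒞 : Set (Set X)) (h𝒞 : ∀ C ∈ 𝒞, MeasurableSet C) (hent : 0 < famEntropy μ 𝒞) :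
    ∃ y : ℝ, 0 < y ∧ ∀ (κ : Type) [Fintype κ] (l : X → κ),
      (∀ J : Set κ, MeasurableSet (l ⁻¹' J)) →
      ∃ C ∈ 𝒞, ∀ J : Set κ, y ≤ μ.real (symmDiff C (l ⁻¹' J)) := by
  unfold famEntropy at hent
  obtain ⟨S, hS⟩ : ∃ S : {f : ℕ → Set X // ∀ i, f i ∈ 𝒞},
      0 < Filter.liminf (fun n : ℕ => joinEntropy μ (fun i : Fin n => S.1 i) / n) Filter.atTop := by
    by_contra h
    push Not at h
    exact absurd (Real.iSup_nonpos h) (not_le.2 hent)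
  rw [Filter.liminf_eq] at hS
  obtain ⟨c, hc, hc0⟩ : ∃ c, (∀ᶠ n : ℕ in atTop, c ≤ joinEntropy μ (fun i : Fin n => S.1 i) / n) ∧
      0 < c := by
    by_contra h
    push Not at h
    exact absurd (Real.sSup_nonpos h) (not_le.2 hS)
  have hl2 : 0 < Real.log 2 := Real.log_pos (by norm_num)
  set c' := c * Real.log 2 with hc'
  have hc'0 : 0 < c' := mul_pos hc0 hl2
  let ε := 1 - Real.exp (-(c' / 4))
  have hε0 : 0 < ε := by
    have : Real.exp (-(c' / 4)) < 1 := by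
      rw [← Real.exp_zero]; exact Real.exp_lt_exp.2 (by linarith)
    simp only [ε]; linarith
  have hε1 : ε < 1 := by
    have := Real.exp_pos (-(c' / 4))
    simp only [ε]; linarith
  have hlog : Real.log ε < 0 := Real.log_neg hε0 hε1
  refine ⟨c' / 4 / (-Real.log ε), div_pos (by linarith) (by linarith), ?_⟩
  intro κ _ l hl
  by_contra hcon
  push Not at hcon
  choose J hJ using fun i => hcon (S.1 i) (S.2 i)
  have key : ∀ n : ℕ, joinEntropy μ (fun i : Fin n => S.1 i) * Real.log 2 ≤
      Real.log (Fintype.card κ) + n * (c' / 4) + n * (c' / 4) := by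
    intro n
    have := aux_joinEntropy_le μ l hl (fun i : Fin n => S.1 i) (fun i => h𝒞 _ (S.2 i))
      (fun i => J i) (c' / 4 / (-Real.log ε)) ε hε0 hε1 (fun i => (hJ i).le)
    have e1 : -Real.log (1 - ε) = c' / 4 := by simp [ε]
    have e2 : c' / 4 / (-Real.log ε) * (-Real.log ε) = c' / 4 :=
      div_mul_cancel₀ _ (neg_pos.2 hlog).ne'
    rw [e1, e2] at this
    exact this
  obtain ⟨n, hn, hn1, hn2⟩ := (hc.and ((eventually_ge_atTop 1).and
    ((tendsto_natCast_atTop_atTop (R := ℝ)).eventually_gt_atTop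
      (Real.log (Fintype.card κ) / (c' / 4))))).exists
  have hn0 : (0 : ℝ) < n := by exact_mod_cast hn1
  rw [le_div_iff₀ hn0] at hn
  rw [div_lt_iff₀ (by linarith)] at hn2
  have := key n
  have h3 : c * n * Real.log 2 ≤ joinEntropy μ (fun i : Fin n => S.1 i) * Real.log 2 :=
    mul_le_mul_of_nonneg_right hn hl2.le
  have h4 : c * n * Real.log 2 = n * c' := by rw [hc']; ring
  nlinarith

end part1


section part2

lemma aux_split {X : Type*} [MeasurableSpace X] [StandardBorelSpace X]
    (μ : Measure X) [IsProbabilityMeasure μ] (hna : ∀ x, μ {x} = 0)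
    (E : Set X) (hE : MeasurableSet E) (c : ℝ) (hc0 : 0 ≤ c) (hc : c ≤ μ.real E) :
    ∃ P ⊆ E, MeasurableSet P ∧ μ.real P = c := by
  rcases hc0.eq_or_lt with h | h0
  · exact ⟨∅, by simp, MeasurableSet.empty, by simp [← h]⟩
  rcases hc.eq_or_lt with h | h1
  · exact ⟨E, subset_rfl, hE, h.symm⟩
  obtain ⟨j, hj⟩ := exists_measurableEmbedding_real X
  let ν := (μ.restrict E).map j
  have hνE : ∀ s, MeasurableSet s → ν.real s = μ.real (E ∩ j ⁻¹' s) := by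
    intro s hs
    simp only [ν]
    rw [map_measureReal_apply hj.measurable hs, measureReal_restrict_apply (hj.measurable hs),
      Set.inter_comm]
  have hat : NullSingletonClass ν := by
    refine ⟨fun t => ?_⟩
    simp only [ν]
    rw [Measure.map_apply hj.measurable (measurableSet_singleton t)]
    refine le_antisymm ((Measure.restrict_apply_le _ _).trans ?_) zero_le
    have : (j ⁻¹' {t}).Subsingleton := by
      intro a ha b hb
      exact hj.injective (ha.trans hb.symm)
    rcases this.eq_empty_or_singleton with h | ⟨x, h⟩
    · simp [h]
    · rw [h, hna]
  have hcont : Continuous (fun t : ℝ => ν.real (Set.Iic t)) := by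
    have : (fun t : ℝ => ν.real (Set.Iic t)) = fun t => ∫ x in Set.Iic t, (1 : ℝ) ∂ν := by
      funext t; simp
    rw [this, continuous_iff_continuousAt]
    intro t
    have h := IntegrableOn.continuousOn_Iic_primitive_Iic (μ := ν) (f := fun _ => (1 : ℝ))
      (a₀ := t + 1) (integrable_const _).integrableOn
    exact h.continuousAt (Iic_mem_nhds (by linarith))
  have hbot : Tendsto (fun t : ℝ => ν.real (Set.Ici t)) atBot (nhds (ν.real Set.univ)) :=
    (ENNReal.tendsto_toReal (measure_ne_top ν _)).comp (tendsto_measure_Ici_atBot ν)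
  have htop : Tendsto (fun t : ℝ => ν.real (Set.Iic t)) atTop (nhds (μ.real E)) := by
    have := tendsto_measure_Iic_atTop ν
    have h2 := (ENNReal.tendsto_toReal (measure_ne_top ν _)).comp this
    have h3 := hνE Set.univ MeasurableSet.univ
    simp only [Set.preimage_univ, Set.inter_univ] at h3
    rw [← h3]
    exact h2
  obtain ⟨a, ha⟩ : ∃ a, ν.real (Set.Iic a) < c := by
    obtain ⟨a, ha⟩ := (hbot.eventually_const_lt (u := ν.real Set.univ - c) (by linarith)).exists
    refine ⟨a, ?_⟩
    have h1 : ν.real (Set.Iio a) + ν.real (Set.Ici a) = ν.real Set.univ := by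
      rw [← Set.compl_Iio, measureReal_add_measureReal_compl measurableSet_Iio]
    have h2 : ν.real (Set.Iic a) = ν.real (Set.Iio a) := measureReal_congr Iio_ae_eq_Iic.symm
    linarith
  obtain ⟨b, hb⟩ := (htop.eventually_const_lt h1).exists
  obtain ⟨t, ht⟩ := mem_range_of_exists_le_of_exists_ge hcont ⟨a, ha.le⟩ ⟨b, hb.le⟩
  refine ⟨E ∩ j ⁻¹' Set.Iic t, Set.inter_subset_left, hE.inter (hj.measurable measurableSet_Iic), ?_⟩
  rw [← hνE _ measurableSet_Iic]
  exact ht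

lemma aux_sum_label {X : Type*} [MeasurableSpace X] (μ : Measure X) [IsProbabilityMeasure μ]
    {κ : Type*} [Fintype κ] (l : X → κ) (hl : ∀ J : Set κ, MeasurableSet (l ⁻¹' J))
    (E : Set X) (hE : MeasurableSet E) : μ.real E = ∑ a, μ.real (E ∩ l ⁻¹' {a}) := by
  have : E = ⋃ a ∈ (Finset.univ : Finset κ), E ∩ l ⁻¹' {a} := by ext x; simp
  conv_lhs => rw [this]
  rw [measureReal_biUnion_finset]
  · intro a _ b _ hab
    rw [Function.onFun, Set.disjoint_left]
    rintro x ⟨_, h1⟩ ⟨_, h2⟩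
    exact hab (h1.symm.trans h2)
  · intro a _
    exact hE.inter (hl _)

lemma aux_split_label {X : Type*} [MeasurableSpace X] [StandardBorelSpace X]
    (μ : Measure X) [IsProbabilityMeasure μ] (hna : ∀ x, μ {x} = 0)
    {κ : Type*} [Fintype κ] (l : X → κ) (hl : ∀ J : Set κ, MeasurableSet (l ⁻¹' J))
    (E : Set X) (hE : MeasurableSet E) (c : κ → ℝ) (hc0 : ∀ a, 0 ≤ c a)
    (hc : ∀ a, c a ≤ μ.real (E ∩ l ⁻¹' {a})) :
    ∃ P ⊆ E, MeasurableSet P ∧ ∀ a, μ.real (P ∩ l ⁻¹' {a}) = c a := by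
  choose P hPE hP hPc using fun a => aux_split μ hna (E ∩ l ⁻¹' {a}) (hE.inter (hl _)) (c a)
    (hc0 a) (hc a)
  refine ⟨⋃ a, P a, Set.iUnion_subset fun a => (hPE a).trans Set.inter_subset_left,
    MeasurableSet.iUnion hP, fun a => ?_⟩
  rw [← hPc a]
  congr 1
  ext x
  simp only [Set.mem_inter_iff, Set.mem_iUnion, Set.mem_preimage, Set.mem_singleton_iff]
  constructor
  · rintro ⟨⟨b, hb⟩, rfl⟩
    have := (hPE b hb).2
    simp only [Set.mem_preimage, Set.mem_singleton_iff] at this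
    rw [this]; exact hb
  · intro h
    exact ⟨⟨a, h⟩, (hPE a h).2⟩

/-- piecewise powers defined by an anti-symmetric measurable index give an involution -/
lemma aux_invol {X : Type*} [MeasurableSpace X] (μ : Measure X)
    (e : ℤ → X ≃ᵐ X) (he : ∀ i, MeasurePreserving (e i) μ μ) (he' : ∀ i x, e (-i) (e i x) = x)
    (k : X → ℤ) (hk : Measurable k) (hk' : ∀ x, k (e (k x) x) = - k x) :
    ∃ τ : X ≃ᵐ X, MeasurePreserving τ μ μ ∧ (∀ x, τ x = e (k x) x) ∧ ∀ x, τ (τ x) = x := by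
  let f : X → X := fun x => e (k x) x
  have hff : ∀ x, f (f x) = x := by
    intro x; simp only [f]; rw [hk', he']
  have hf : Measurable f := by
    have : Measurable (fun p : X × ℤ => e p.2 p.1) :=
      measurable_from_prod_countable_left fun i => (e i).measurable
    exact this.comp (measurable_id.prodMk hk)
  have hmp : MeasurePreserving f μ μ := by
    refine ⟨hf, ?_⟩
    ext B hB
    rw [Measure.map_apply hf hB]
    have hS : ∀ g : X → ℤ, Measurable g → ∀ B, MeasurableSet B →
        μ B = ∑' i, μ (g ⁻¹' {i} ∩ B) := by
      intro g hg B hB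
      rw [← measure_iUnion]
      · congr 1; ext x; simp
      · intro i j hij
        rw [Function.onFun, Set.disjoint_left]
        rintro x ⟨h1, _⟩ ⟨h2, _⟩
        exact hij (h1.symm.trans h2)
      · intro i; exact (hg (measurableSet_singleton i)).inter hB
    rw [hS k hk _ (hf hB), hS (k ∘ f) (hk.comp hf) B hB]
    refine tsum_congr fun i => ?_
    rw [← (he i).measure_preimage
      (((hk.comp hf) (measurableSet_singleton i)).inter hB).nullMeasurableSet]
    congr 1
    ext x
    simp only [Set.mem_inter_iff, Set.mem_preimage, Set.mem_singleton_iff, Function.comp]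
    constructor
    · rintro ⟨h1, h2⟩
      have h3 : e i x = f x := by simp only [f, h1]
      rw [h3, hff]
      exact ⟨h1, h2⟩
    · rintro ⟨h1, h2⟩
      have h3 : e i (f (e i x)) = e i x := by
        conv_rhs => rw [← hff (e i x)]
        conv_rhs => rw [show f (f (e i x)) = e (k (f (e i x))) (f (e i x)) from rfl, h1]
      have h4 := (e i).injective h3
      rw [h4] at h1
      refine ⟨h1, ?_⟩
      have h5 : f x = e i x := by simp only [f, h1]
      rw [h5]; exact h2
  refine ⟨⟨⟨f, f, hff, hff⟩, hf, hf⟩, hmp, fun x => rfl, hff⟩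

end part2


section part3

lemma aux_powers {X : Type*} [MeasurableSpace X] (μ : Measure X)
    (T : X ≃ᵐ X) (hT : MeasurePreserving T μ μ) :
    ∃ e : ℤ → X ≃ᵐ X, (∀ i, MeasurePreserving (e i) μ μ) ∧ (∀ i x, e (-i) (e i x) = x) ∧
      ∀ n : ℕ, ∀ x, e n x = (⇑T)^[n] x := by
  have hS : MeasurePreserving T.symm μ μ := hT.symm T
  let U : Equiv.Perm X := T.toEquiv
  have hUn : ∀ n : ℕ, ⇑(U ^ n) = (⇑T)^[n] := fun n => (Equiv.Perm.iterate_eq_pow U n).symm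
  have hVn : ∀ n : ℕ, ⇑((U⁻¹) ^ n) = (⇑T.symm)^[n] := fun n => (Equiv.Perm.iterate_eq_pow U⁻¹ n).symm
  have hm : ∀ i : ℤ, MeasurePreserving ⇑(U ^ i) μ μ := by
    intro i
    obtain ⟨n, rfl | rfl⟩ := i.eq_nat_or_neg
    · rw [zpow_natCast, hUn]; exact hT.iterate n
    · rw [zpow_neg, zpow_natCast, ← inv_pow, hVn]; exact hS.iterate n
  have hinv : ∀ i : ℤ, ∀ x, (U ^ (-i)) ((U ^ i) x) = x := by
    intro i x
    rw [← Equiv.Perm.mul_apply, ← zpow_add]; simp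
  have hinv' : ∀ i : ℤ, ∀ x, (U ^ i) ((U ^ (-i)) x) = x := by
    intro i x
    rw [← Equiv.Perm.mul_apply, ← zpow_add]; simp
  refine ⟨fun i => ⟨⟨⇑(U ^ i), ⇑(U ^ (-i)), hinv i, hinv' i⟩, (hm i).measurable, (hm (-i)).measurable⟩,
    hm, hinv, fun n x => ?_⟩
  change (U ^ (n : ℤ)) x = _
  rw [zpow_natCast, hUn]

open Classical in
lemma aux_swap {X : Type*} [MeasurableSpace X] (μ : Measure X) [IsProbabilityMeasure μ]
    (T : X ≃ᵐ X) (hT : MeasurePreserving T μ μ)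
    (hmix : ∀ A B : Set X, MeasurableSet A → MeasurableSet B →
      Tendsto (fun n : ℕ => μ.real (A ∩ ((⇑T)^[n]) ⁻¹' B)) atTop
        (nhds (μ.real A * μ.real B)))
    {κ : Type*} [Fintype κ] (l : X → κ) (hl : ∀ J : Set κ, MeasurableSet (l ⁻¹' J))
    (E F : Set X) (hE : MeasurableSet E) (hF : MeasurableSet F) (hEF : Disjoint E F)
    (hlab : ∀ a, μ.real (E ∩ l ⁻¹' {a}) = μ.real (F ∩ l ⁻¹' {a})) :
    ∃ τ : X ≃ᵐ X, MeasurePreserving τ μ μ ∧ (∀ x, τ (τ x) = x) ∧ (∀ x, l (τ x) = l x) ∧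
      (∀ x, x ∉ E → x ∉ F → τ x = x) ∧ (∀ᵐ x ∂μ, x ∈ E → τ x ∈ F) ∧
      (∀ᵐ x ∂μ, x ∈ F → τ x ∈ E) := by
  obtain ⟨e, he, he', heT⟩ := aux_powers μ T hT
  have he'' : ∀ i x, e i (e (-i) x) = x := by
    intro i x
    have := he' (-i) x
    rwa [neg_neg] at this
  let _ : MeasurableSpace κ := ⊤
  have hlm : Measurable l := fun J _ => hl J
  -- matched part at stage n
  let M : ℕ → Set X → Set X → Set X := fun n E F => {x | x ∈ E ∧ e n x ∈ F ∧ l (e n x) = l x}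
  let s : ℕ → Set X × Set X := fun n => Nat.rec (E, F)
    (fun n p => (p.1 \ M n p.1 p.2, {y | y ∈ p.2 ∧ e (-n) y ∉ M n p.1 p.2})) n
  have hs0 : s 0 = (E, F) := rfl
  have hs : ∀ n, s (n + 1) = ((s n).1 \ M n (s n).1 (s n).2,
    {y | y ∈ (s n).2 ∧ e (-n) y ∉ M n (s n).1 (s n).2}) := fun n => rfl
  have hMmeas : ∀ n A B, MeasurableSet A → MeasurableSet B → MeasurableSet (M n A B) := by
    intro n A B hA hB
    refine hA.inter (((e n).measurable hB).inter ?_)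
    exact measurableSet_eq_fun (hlm.comp (e n).measurable) hlm
  have hsm : ∀ n, MeasurableSet (s n).1 ∧ MeasurableSet (s n).2 := by
    intro n
    induction n with
    | zero => exact ⟨hE, hF⟩
    | succ n ih =>
      rw [hs]
      refine ⟨ih.1.diff (hMmeas _ _ _ ih.1 ih.2), ih.2.inter ?_⟩
      exact ((e (-n)).measurable (hMmeas _ _ _ ih.1 ih.2)).compl
  let A : ℕ → Set X := fun n => M n (s n).1 (s n).2
  let B : ℕ → Set X := fun n => {y | e (-n) y ∈ A n}
  have hA : ∀ n, MeasurableSet (A n) := fun n => hMmeas _ _ _ (hsm n).1 (hsm n).2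
  have hB : ∀ n, MeasurableSet (B n) := fun n => (e (-n)).measurable (hA n)
  have hmem1 : ∀ n x, x ∈ (s n).1 ↔ x ∈ E ∧ ∀ m < n, x ∉ A m := by
    intro n
    induction n with
    | zero => intro x; simp [hs0]
    | succ n ih =>
      intro x
      rw [hs]
      simp only [Set.mem_sdiff, ih, Nat.lt_succ_iff_lt_or_eq]
      constructor
      · rintro ⟨⟨h1, h2⟩, h3⟩
        refine ⟨h1, ?_⟩
        rintro m (hm | rfl)
        · exact h2 m hm
        · exact h3
      · rintro ⟨h1, h2⟩
        exact ⟨⟨h1, fun m hm => h2 m (Or.inl hm)⟩, h2 n (Or.inr rfl)⟩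
  have hmem2 : ∀ n x, x ∈ (s n).2 ↔ x ∈ F ∧ ∀ m < n, x ∉ B m := by
    intro n
    induction n with
    | zero => intro x; simp [hs0]
    | succ n ih =>
      intro x
      rw [hs]
      simp only [Set.mem_ofPred_eq, ih, Nat.lt_succ_iff_lt_or_eq]
      constructor
      · rintro ⟨⟨h1, h2⟩, h3⟩
        refine ⟨h1, ?_⟩
        rintro m (hm | rfl)
        · exact h2 m hm
        · exact h3
      · rintro ⟨h1, h2⟩
        exact ⟨⟨h1, fun m hm => h2 m (Or.inl hm)⟩, h2 n (Or.inr rfl)⟩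
  have hAE : ∀ n x, x ∈ A n → x ∈ E := fun n x h => ((hmem1 n x).1 h.1).1
  have hAl : ∀ n x, x ∈ A n → l (e n x) = l x := fun n x h => h.2.2
  have hAB : ∀ n x, x ∈ A n → e n x ∈ B n := by
    intro n x h
    change e (-n) (e n x) ∈ A n
    rw [he']; exact h
  have hBs : ∀ n x, x ∈ B n → x ∈ (s n).2 := by
    intro n x h
    have := h.2.1
    rwa [he''] at this
  have hBF : ∀ n x, x ∈ B n → x ∈ F := fun n x h => ((hmem2 n x).1 (hBs n x h)).1
  have hBl : ∀ n x, x ∈ B n → l (e (-n) x) = l x := by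
    intro n x h
    have := h.2.2
    rw [he''] at this
    exact this.symm
  have hAu : ∀ n m x, x ∈ A n → x ∈ A m → n = m := by
    intro n m x h1 h2
    rcases lt_trichotomy n m with h | h | h
    · exact absurd h1 (((hmem1 m x).1 h2.1).2 n h)
    · exact h
    · exact absurd h2 (((hmem1 n x).1 h1.1).2 m h)
  have hBu : ∀ n m x, x ∈ B n → x ∈ B m → n = m := by
    intro n m x h1 h2
    rcases lt_trichotomy n m with h | h | h
    · exact absurd h1 (((hmem2 m x).1 (hBs _ _ h2)).2 n h)
    · exact h
    · exact absurd h2 (((hmem2 n x).1 (hBs _ _ h1)).2 m h)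
  have hdisj : ∀ x, x ∈ E → x ∈ F → False := fun x h1 h2 => Set.disjoint_left.1 hEF h1 h2
  let p : X → ℕ → Prop := fun x n => x ∈ A n ∨ x ∈ B n ∨ ∀ m, x ∉ A m ∧ x ∉ B m
  have hp : ∀ x, ∃ n, p x n := by
    intro x
    by_cases h : ∀ m, x ∉ A m ∧ x ∉ B m
    · exact ⟨0, Or.inr (Or.inr h)⟩
    · push Not at h
      obtain ⟨m, hm⟩ := h
      by_cases h1 : x ∈ A m
      · exact ⟨m, Or.inl h1⟩
      · exact ⟨m, Or.inr (Or.inl (hm h1))⟩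
  let N : X → ℕ := fun x => Nat.find (hp x)
  have hN : Measurable N := by
    refine measurable_find hp fun n => ?_
    refine (hA n).union ((hB n).union ?_)
    have : {x | ∀ m, x ∉ A m ∧ x ∉ B m} = ⋂ m, ((A m)ᶜ ∩ (B m)ᶜ) := by ext x; simp
    change MeasurableSet {x | ∀ m, x ∉ A m ∧ x ∉ B m}
    rw [this]
    exact MeasurableSet.iInter fun m => (hA m).compl.inter (hB m).compl
  have hNA : ∀ n x, x ∈ A n → N x = n := by
    intro n x h
    rcases Nat.find_spec (hp x) with h1 | h1 | h1
    · exact hAu _ _ x h1 h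
    · exact (hdisj x (hAE _ _ h) (hBF _ _ h1)).elim
    · exact absurd h (h1 n).1
  have hNB : ∀ n x, x ∈ B n → N x = n := by
    intro n x h
    rcases Nat.find_spec (hp x) with h1 | h1 | h1
    · exact (hdisj x (hAE _ _ h1) (hBF _ _ h)).elim
    · exact hBu _ _ x h1 h
    · exact absurd h (h1 n).2
  have hN0 : ∀ x, (∀ m, x ∉ A m ∧ x ∉ B m) → N x = 0 := by
    intro x h
    exact (Nat.find_eq_zero (hp x)).2 (Or.inr (Or.inr h))
  let k : X → ℤ := fun x => if x ∈ F then -(N x : ℤ) else (N x : ℤ)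
  have hk : Measurable k := by
    refine Measurable.ite hF ?_ ?_
    · exact (measurable_of_countable (fun n : ℕ => -(n : ℤ))).comp hN
    · exact (measurable_of_countable (fun n : ℕ => (n : ℤ))).comp hN
  have hkA : ∀ n x, x ∈ A n → k x = n := by
    intro n x h
    have : x ∉ F := fun h' => hdisj x (hAE _ _ h) h'
    simp only [k, this, if_false, hNA n x h]
  have hkB : ∀ n x, x ∈ B n → k x = -n := by
    intro n x h
    simp only [k, hBF _ _ h, if_true, hNB n x h]
  have hk0 : ∀ x, (∀ m, x ∉ A m ∧ x ∉ B m) → k x = 0 := by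
    intro x h
    simp [k, hN0 x h]
  have he0 : ∀ x, e 0 x = x := by
    intro x; have := heT 0 x; simpa using this
  have hcases : ∀ x, (∃ n, x ∈ A n) ∨ (∃ n, x ∈ B n) ∨ ∀ m, x ∉ A m ∧ x ∉ B m := by
    intro x
    obtain ⟨n, h | h | h⟩ := hp x
    · exact Or.inl ⟨n, h⟩
    · exact Or.inr (Or.inl ⟨n, h⟩)
    · exact Or.inr (Or.inr h)
  have hk' : ∀ x, k (e (k x) x) = - k x := by
    intro x
    rcases hcases x with ⟨n, h⟩ | ⟨n, h⟩ | h
    · rw [hkA n x h, hkB n _ (hAB n x h)]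
    · rw [hkB n x h, hkA n (e (-n) x) h, neg_neg]
    · rw [hk0 x h, he0, hk0 x h]; rfl
  obtain ⟨τ, hτ, hτk, hττ⟩ := aux_invol μ e he he' k hk hk'
  have hτA : ∀ n x, x ∈ A n → τ x ∈ B n := by
    intro n x h; rw [hτk, hkA n x h]; exact hAB n x h
  have hτB : ∀ n x, x ∈ B n → τ x ∈ A n := by
    intro n x h; rw [hτk, hkB n x h]; exact h
  have hτl : ∀ x, l (τ x) = l x := by
    intro x
    rw [hτk]
    rcases hcases x with ⟨n, h⟩ | ⟨n, h⟩ | h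
    · rw [hkA n x h]; exact hAl n x h
    · rw [hkB n x h]; exact hBl n x h
    · rw [hk0 x h, he0]
  -- residual sets
  let Ei : Set X := E \ ⋃ n, A n
  let Fi : Set X := F \ ⋃ n, B n
  have hEi : MeasurableSet Ei := hE.diff (MeasurableSet.iUnion hA)
  have hFi : MeasurableSet Fi := hF.diff (MeasurableSet.iUnion hB)
  have hempty : ∀ a n, (Ei ∩ l ⁻¹' {a}) ∩ ((⇑T)^[n]) ⁻¹' (Fi ∩ l ⁻¹' {a}) = ∅ := by
    intro a n
    rw [Set.eq_empty_iff_forall_notMem]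
    rintro x ⟨⟨⟨h1, h2⟩, h3⟩, ⟨h4, h5⟩, h6⟩
    rw [← heT] at h4 h5 h6
    apply h2
    rw [Set.mem_iUnion]
    refine ⟨n, (hmem1 n x).2 ⟨h1, fun m _ hm => h2 (Set.mem_iUnion.2 ⟨m, hm⟩)⟩,
      (hmem2 n _).2 ⟨h4, fun m _ hm => h5 (Set.mem_iUnion.2 ⟨m, hm⟩)⟩, ?_⟩
    exact Eq.trans h6 (Eq.symm h3)
  have hprod : ∀ a, μ.real (Ei ∩ l ⁻¹' {a}) * μ.real (Fi ∩ l ⁻¹' {a}) = 0 := by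
    intro a
    have h := hmix _ _ (hEi.inter (hl {a})) (hFi.inter (hl {a}))
    simp only [hempty, measureReal_empty] at h
    exact tendsto_nhds_unique h tendsto_const_nhds
  have heq : ∀ a, μ.real (Ei ∩ l ⁻¹' {a}) = μ.real (Fi ∩ l ⁻¹' {a}) := by
    intro a
    have h1 : μ.real (E ∩ l ⁻¹' {a}) = μ.real (Ei ∩ l ⁻¹' {a}) +
        μ.real ((⋃ n, A n) ∩ l ⁻¹' {a}) := by
      rw [← measureReal_union]
      · congr 1
        ext x
        simp only [Ei, Set.mem_inter_iff, Set.mem_union, Set.mem_sdiff]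
        constructor
        · rintro ⟨h1, h2⟩
          by_cases h3 : x ∈ ⋃ n, A n
          · exact Or.inr ⟨h3, h2⟩
          · exact Or.inl ⟨⟨h1, h3⟩, h2⟩
        · rintro (⟨⟨h1, _⟩, h2⟩ | ⟨h1, h2⟩)
          · exact ⟨h1, h2⟩
          · obtain ⟨n, hn⟩ := Set.mem_iUnion.1 h1
            exact ⟨hAE n x hn, h2⟩
      · rw [Set.disjoint_left]
        rintro x ⟨⟨_, h1⟩, _⟩ ⟨h2, _⟩
        exact h1 h2
      · exact (MeasurableSet.iUnion hA).inter (hl _)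
    have h2 : μ.real (F ∩ l ⁻¹' {a}) = μ.real (Fi ∩ l ⁻¹' {a}) +
        μ.real ((⋃ n, B n) ∩ l ⁻¹' {a}) := by
      rw [← measureReal_union]
      · congr 1
        ext x
        simp only [Fi, Set.mem_inter_iff, Set.mem_union, Set.mem_sdiff]
        constructor
        · rintro ⟨h1, h2⟩
          by_cases h3 : x ∈ ⋃ n, B n
          · exact Or.inr ⟨h3, h2⟩
          · exact Or.inl ⟨⟨h1, h3⟩, h2⟩
        · rintro (⟨⟨h1, _⟩, h2⟩ | ⟨h1, h2⟩)
          · exact ⟨h1, h2⟩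
          · obtain ⟨n, hn⟩ := Set.mem_iUnion.1 h1
            exact ⟨hBF n x hn, h2⟩
      · rw [Set.disjoint_left]
        rintro x ⟨⟨_, h1⟩, _⟩ ⟨h2, _⟩
        exact h1 h2
      · exact (MeasurableSet.iUnion hB).inter (hl _)
    have h3 : μ.real ((⋃ n, A n) ∩ l ⁻¹' {a}) = μ.real ((⋃ n, B n) ∩ l ⁻¹' {a}) := by
      rw [← hτ.measureReal_preimage ((MeasurableSet.iUnion hB).inter (hl _)).nullMeasurableSet]
      congr 1
      ext x
      simp only [Set.mem_inter_iff, Set.mem_preimage, Set.mem_iUnion, Set.mem_singleton_iff, hτl]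
      refine and_congr_left fun _ => ⟨fun ⟨n, h⟩ => ⟨n, hτA n x h⟩, fun ⟨n, h⟩ => ⟨n, ?_⟩⟩
      have := hτB n _ h
      rwa [hττ] at this
    have := hlab a
    linarith
  have hz1 : ∀ a, μ.real (Ei ∩ l ⁻¹' {a}) = 0 := by
    intro a
    have := hprod a
    rw [← heq a] at this
    exact mul_self_eq_zero.1 this
  have hz2 : ∀ a, μ.real (Fi ∩ l ⁻¹' {a}) = 0 := fun a => by rw [← heq a, hz1 a]
  have hEi0 : μ Ei = 0 := by
    rw [← measureReal_eq_zero_iff, aux_sum_label μ l hl Ei hEi]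
    exact Finset.sum_eq_zero fun a _ => hz1 a
  have hFi0 : μ Fi = 0 := by
    rw [← measureReal_eq_zero_iff, aux_sum_label μ l hl Fi hFi]
    exact Finset.sum_eq_zero fun a _ => hz2 a
  refine ⟨τ, hτ, hττ, hτl, ?_, ?_, ?_⟩
  · intro x h1 h2
    rw [hτk, hk0 x fun m => ⟨fun h => h1 (hAE _ _ h), fun h => h2 (hBF _ _ h)⟩, he0]
  · filter_upwards [measure_eq_zero_iff_ae_notMem.1 hEi0] with x hx hxE
    have : x ∈ ⋃ n, A n := by
      by_contra h; exact hx ⟨hxE, h⟩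
    obtain ⟨n, hn⟩ := Set.mem_iUnion.1 this
    exact hBF n _ (hτA n x hn)
  · filter_upwards [measure_eq_zero_iff_ae_notMem.1 hFi0] with x hx hxF
    have : x ∈ ⋃ n, B n := by
      by_contra h; exact hx ⟨hxF, h⟩
    obtain ⟨n, hn⟩ := Set.mem_iUnion.1 this
    exact hAE n _ (hτB n x hn)

end part3


section part4

lemma aux_median {X : Type*} [MeasurableSpace X] [StandardBorelSpace X]
    (μ : Measure X) [IsProbabilityMeasure μ] (hna : ∀ x, μ {x} = 0)
    (Z : Set X) (hZ : MeasurableSet Z) (g : X → ℝ) (hg : Measurable g)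
    (hgi : ∀ x, ∃ k : ℕ, g x = (k : ℝ) - 2) (hg2 : ∀ x, |g x| ≤ 2) :
    ∃ V ⊆ Z, MeasurableSet V ∧ μ.real V = μ.real Z / 2 ∧
      ∫ x in Z, |g x| ∂μ ≤ 2 * (∫ x in V, g x ∂μ - ∫ x in Z \ V, g x ∂μ) + |∫ x in Z, g x ∂μ| := by
  classical
  have hint : Integrable g μ := Integrable.of_bound hg.aestronglyMeasurable 2
    (Filter.Eventually.of_forall fun x => by simpa using hg2 x)
  have hex : ∃ j : ℕ, μ.real (Z ∩ {x | (j : ℝ) - 2 < g x}) ≤ μ.real Z / 2 := by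
    refine ⟨4, ?_⟩
    have : Z ∩ {x | ((4 : ℕ) : ℝ) - 2 < g x} = ∅ := by
      rw [Set.eq_empty_iff_forall_notMem]
      rintro x ⟨_, h⟩
      have h' : ((4 : ℕ) : ℝ) - 2 < g x := h
      have := (abs_le.1 (hg2 x)).2
      push_cast at h'
      linarith
    rw [this]; simp; positivity
  set k := Nat.find hex with hk
  have hkspec : μ.real (Z ∩ {x | (k : ℝ) - 2 < g x}) ≤ μ.real Z / 2 := Nat.find_spec hex
  set m : ℝ := (k : ℝ) - 2 with hm
  let U : Set X := Z ∩ {x | m < g x}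
  let W : Set X := Z ∩ {x | m ≤ g x}
  have hU : MeasurableSet U := hZ.inter (measurableSet_lt measurable_const hg)
  have hW : MeasurableSet W := hZ.inter (measurableSet_le measurable_const hg)
  have hUW : U ⊆ W := fun x hx => ⟨hx.1, by
    have h : m < g x := hx.2
    exact (show m ≤ g x from h.le)⟩
  have hWge : μ.real Z / 2 ≤ μ.real W := by
    rcases Nat.eq_zero_or_pos k with h0 | hpos
    · have : W = Z := by
        refine Set.inter_eq_left.2 fun x _ => ?_
        change m ≤ g x
        rw [hm, h0]
        have := (abs_le.1 (hg2 x)).1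
        push_cast; linarith
      rw [this]
      have : 0 ≤ μ.real Z := measureReal_nonneg
      linarith
    · have h1 := Nat.find_min hex (m := k - 1) (by omega)
      have h2 : W = Z ∩ {x | ((k - 1 : ℕ) : ℝ) - 2 < g x} := by
        ext x
        refine and_congr_right fun _ => ?_
        change m ≤ g x ↔ ((k - 1 : ℕ) : ℝ) - 2 < g x
        obtain ⟨j, hj⟩ := hgi x
        rw [hj, hm, Nat.cast_sub (by omega)]
        constructor
        · intro h; push_cast; linarith
        · intro h
          have : (k : ℝ) < j + 1 := by push_cast at h; linarith
          have : k < j + 1 := by exact_mod_cast this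
          have : k ≤ j := by omega
          have : (k : ℝ) ≤ j := by exact_mod_cast this
          linarith
      rw [h2]; exact (not_le.1 h1).le
  have hdiff : μ.real (W \ U) = μ.real W - μ.real U := measureReal_sdiff hUW hU
  obtain ⟨P, hPs, hP, hPm⟩ := aux_split μ hna (W \ U) (hW.diff hU) (μ.real Z / 2 - μ.real U)
    (by linarith) (by linarith)
  let V := U ∪ P
  have hV : MeasurableSet V := hU.union hP
  have hVZ : V ⊆ Z := by
    rintro x (h | h)
    · exact h.1
    · exact (hPs h).1.1
  have hVm : μ.real V = μ.real Z / 2 := by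
    rw [measureReal_union ?_ hP, hPm]; ring
    exact Set.disjoint_left.2 fun x h1 h2 => (hPs h2).2 h1
  have hZV : μ.real (Z \ V) = μ.real Z / 2 := by
    rw [measureReal_sdiff hVZ hV, hVm]; ring
  have hVge : ∀ x ∈ V, m ≤ g x := by
    rintro x (h | h)
    · have h' : m < g x := h.2
      exact h'.le
    · exact (hPs h).1.2
  have hVle : ∀ x ∈ Z \ V, g x ≤ m := by
    rintro x ⟨h1, h2⟩
    by_contra h
    exact h2 (Or.inl ⟨h1, by
      have h' : m < g x := not_le.1 h
      exact h'⟩)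
  refine ⟨V, hVZ, hV, hVm, ?_⟩
  have hdec : ∀ f : X → ℝ, Integrable f μ →
      ∫ x in Z, f x ∂μ = ∫ x in V, f x ∂μ + ∫ x in Z \ V, f x ∂μ := by
    intro f hf
    rw [← setIntegral_union Set.disjoint_sdiff_right (hZ.diff hV) hf.integrableOn hf.integrableOn,
      Set.union_sdiff_cancel hVZ]
  have hgm : Integrable (fun x => g x - m) μ := hint.sub (integrable_const _)
  have hI1 : ∫ x in V, |g x - m| ∂μ = ∫ x in V, g x ∂μ - m * (μ.real Z / 2) := by
    rw [setIntegral_congr_fun (g := fun x => g x - m) hV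
      (fun x hx => abs_of_nonneg (sub_nonneg.2 (hVge x hx))),
      integral_sub hint.integrableOn (integrable_const _)]
    simp [hVm]; ring
  have hI2 : ∫ x in Z \ V, |g x - m| ∂μ = m * (μ.real Z / 2) - ∫ x in Z \ V, g x ∂μ := by
    rw [setIntegral_congr_fun (g := fun x => m - g x) (hZ.diff hV)
      (fun x hx => by
        change |g x - m| = m - g x
        rw [abs_of_nonpos (sub_nonpos.2 (hVle x hx))]; ring),
      integral_sub (integrable_const _) hint.integrableOn]
    simp [hZV]; ring
  have hI := hdec (fun x => |g x - m|) hgm.abs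
  have h1 : ∫ x in Z, |g x| ∂μ ≤ ∫ x in Z, (|g x - m| + |m|) ∂μ := by
    refine integral_mono hint.abs.integrableOn
      ((hgm.abs.add (integrable_const _)).integrableOn) fun x => ?_
    have := abs_add_le (g x - m) m
    simpa using this
  rw [integral_add hgm.abs.integrableOn (integrable_const _)] at h1
  have h2 : ∫ x in Z, |m| ∂μ = |m| * μ.real Z := by simp; ring
  have h3 : |m * μ.real Z| ≤ ∫ x in Z, |g x - m| ∂μ + |∫ x in Z, g x ∂μ| := by
    have e1 : ∫ x in Z, (g x - m) ∂μ = ∫ x in Z, g x ∂μ - m * μ.real Z := by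
      rw [integral_sub hint.integrableOn (integrable_const _)]; simp; ring
    have e2 : |∫ x in Z, (g x - m) ∂μ| ≤ ∫ x in Z, |g x - m| ∂μ := abs_integral_le_integral_abs
    rw [e1] at e2
    have e3 := abs_sub_abs_le_abs_sub (m * μ.real Z) (∫ x in Z, g x ∂μ)
    rw [abs_sub_comm] at e3
    linarith
  rw [abs_mul, abs_of_nonneg (measureReal_nonneg (μ := μ) (s := Z))] at h3
  linarith

end part4


section part5

lemma aux_g {X : Type*} [MeasurableSpace X]
    (μ : Measure X) [IsProbabilityMeasure μ]
    (T : X ≃ᵐ X) (hT : MeasurePreserving T μ μ) (n : ℕ) (P P' : Set X)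
    (hP : MeasurableSet P) (hP' : MeasurableSet P') (hPP : Disjoint P P') :
    ∃ g : X → ℝ, Measurable g ∧ (∀ x, ∃ k : ℕ, g x = (k : ℝ) - 2) ∧ (∀ x, |g x| ≤ 2) ∧
      (∀ V, MeasurableSet V → ∫ x in V, g x ∂μ =
        μ.real (V ∩ (⇑T)^[n] ⁻¹' P) - μ.real (V ∩ (⇑T)^[n] ⁻¹' P') +
        μ.real (P ∩ (⇑T)^[n] ⁻¹' V) - μ.real (P' ∩ (⇑T)^[n] ⁻¹' V)) ∧
      (∀ Z, MeasurableSet Z → μ.real (Z ∩ (⇑T)^[n] ⁻¹' (P ∪ P')) -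
        μ.real ((P ∪ P') ∩ (⇑T)^[2 * n] ⁻¹' (P ∪ P')) ≤ ∫ x in Z, |g x| ∂μ) := by
  classical
  have hTn := hT.iterate n
  have hS : Measurable (⇑T.symm)^[n] := T.symm.measurable.iterate n
  have hST : ∀ x, (⇑T.symm)^[n] ((⇑T)^[n] x) = x :=
    Function.LeftInverse.iterate T.symm_apply_apply n
  have hpull : ∀ V Q : Set X, MeasurableSet V → MeasurableSet Q →
      μ.real (V ∩ (⇑T.symm)^[n] ⁻¹' Q) = μ.real (Q ∩ (⇑T)^[n] ⁻¹' V) := by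
    intro V Q hV hQ
    rw [measureReal_def, measureReal_def, ← hTn.measure_preimage (hV.inter (hS hQ)).nullMeasurableSet]
    congr 2
    ext x
    simp only [Set.mem_preimage, Set.mem_inter_iff, hST]
    tauto
  set A1 := (⇑T)^[n] ⁻¹' P with hA1
  set A2 := (⇑T)^[n] ⁻¹' P' with hA2
  set B1 := (⇑T.symm)^[n] ⁻¹' P with hB1
  set B2 := (⇑T.symm)^[n] ⁻¹' P' with hB2
  have mA1 : MeasurableSet A1 := hTn.measurable hP
  have mA2 : MeasurableSet A2 := hTn.measurable hP'
  have mB1 : MeasurableSet B1 := hS hP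
  have mB2 : MeasurableSet B2 := hS hP'
  have dA : ∀ x, x ∈ A1 → x ∈ A2 → False := fun x h1 h2 => Set.disjoint_left.1 hPP h1 h2
  have dB : ∀ x, x ∈ B1 → x ∈ B2 → False := fun x h1 h2 => Set.disjoint_left.1 hPP h1 h2
  let i : Set X → X → ℝ := fun A => A.indicator 1
  have ii : ∀ A, MeasurableSet A → Integrable (i A) μ := fun A hA =>
    (integrable_const (1:ℝ)).indicator hA
  have iI : ∀ V A, MeasurableSet V → MeasurableSet A → ∫ x in V, i A x ∂μ = μ.real (V ∩ A) := by
    intro V A hV hA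
    simp only [i]
    rw [integral_indicator_one hA, measureReal_restrict_apply hA, Set.inter_comm]
  have mi : ∀ A, MeasurableSet A → Measurable (i A) := fun A hA => measurable_one.indicator hA
  have hgm : Measurable (fun x => i A1 x - i A2 x + i B1 x - i B2 x) :=
    (((mi _ mA1).sub (mi _ mA2)).add (mi _ mB1)).sub (mi _ mB2)
  have hgb : ∀ x, |i A1 x - i A2 x + i B1 x - i B2 x| ≤ 2 := by
    intro x
    have := dA x
    have := dB x
    by_cases h1 : x ∈ A1 <;> by_cases h2 : x ∈ A2 <;> by_cases h3 : x ∈ B1 <;>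
      by_cases h4 : x ∈ B2 <;> simp [i, h1, h2, h3, h4] <;> norm_num <;> simp_all
  have hgint : Integrable (fun x => i A1 x - i A2 x + i B1 x - i B2 x) μ :=
    (((ii _ mA1).sub (ii _ mA2)).add (ii _ mB1)).sub (ii _ mB2)
  refine ⟨fun x => i A1 x - i A2 x + i B1 x - i B2 x, hgm, ?_, hgb, ?_, ?_⟩
  · intro x
    refine ⟨(if x ∈ A1 then 1 else 0) + (if x ∈ A2 then 0 else 1) + (if x ∈ B1 then 1 else 0)
      + (if x ∈ B2 then 0 else 1), ?_⟩
    by_cases h1 : x ∈ A1 <;> by_cases h2 : x ∈ A2 <;> by_cases h3 : x ∈ B1 <;>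
      by_cases h4 : x ∈ B2 <;> simp [i, h1, h2, h3, h4] <;> norm_num
  · intro V hV
    have j1 : IntegrableOn (fun x => i A1 x - i A2 x) V μ := ((ii _ mA1).sub (ii _ mA2)).integrableOn
    have j2 : IntegrableOn (fun x => i A1 x - i A2 x + i B1 x) V μ :=
      (((ii _ mA1).sub (ii _ mA2)).add (ii _ mB1)).integrableOn
    change ∫ x in V, (i A1 x - i A2 x + i B1 x - i B2 x) ∂μ = _
    rw [integral_sub j2 (ii _ mB2).integrableOn,
      integral_add j1 (ii _ mB1).integrableOn,
      integral_sub (ii _ mA1).integrableOn (ii _ mA2).integrableOn,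
      iI _ _ hV mA1, iI _ _ hV mA2, iI _ _ hV mB1, iI _ _ hV mB2, hB1, hB2,
      hpull V P hV hP, hpull V P' hV hP']
  · intro Z hZ
    have e1 : (⇑T)^[n] ⁻¹' (P ∪ P') = A1 ∪ A2 := rfl
    have e2 : μ.real ((A1 ∪ A2) ∩ (B1 ∪ B2)) = μ.real ((P ∪ P') ∩ (⇑T)^[2 * n] ⁻¹' (P ∪ P')) := by
      have := hpull (A1 ∪ A2) (P ∪ P') (mA1.union mA2) (hP.union hP')
      rw [two_mul, Function.iterate_add]
      exact this
    have m12 := mA1.union mA2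
    have mm := m12.inter (mB1.union mB2)
    have h1 : ∫ x in Z, (i (A1 ∪ A2) x - i ((A1 ∪ A2) ∩ (B1 ∪ B2)) x) ∂μ ≤
        ∫ x in Z, |i A1 x - i A2 x + i B1 x - i B2 x| ∂μ := by
      refine integral_mono ((ii _ m12).sub (ii _ mm)).integrableOn hgint.abs.integrableOn fun x => ?_
      have := dA x
      have := dB x
      by_cases h1 : x ∈ A1 <;> by_cases h2 : x ∈ A2 <;> by_cases h3 : x ∈ B1 <;>
        by_cases h4 : x ∈ B2 <;> simp [i, h1, h2, h3, h4] <;> norm_num <;> simp_all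
    rw [integral_sub (ii _ m12).integrableOn (ii _ mm).integrableOn, iI _ _ hZ m12,
      iI _ _ hZ mm] at h1
    have h2 : μ.real (Z ∩ ((A1 ∪ A2) ∩ (B1 ∪ B2))) ≤ μ.real ((A1 ∪ A2) ∩ (B1 ∪ B2)) :=
      measureReal_mono Set.inter_subset_right
    rw [e1, ← e2]
    linarith

lemma aux_polar {X : Type*} [MeasurableSpace X]
    (μ : Measure X) [IsProbabilityMeasure μ] (S : X → X) (hS : Measurable S)
    (R P P' V V' : Set X) (hR : MeasurableSet R) (hP : MeasurableSet P) (hP' : MeasurableSet P')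
    (hV : MeasurableSet V) (hV' : MeasurableSet V')
    (d1 : Disjoint R P) (d2 : Disjoint R P') (d3 : Disjoint R V) (d4 : Disjoint R V')
    (d5 : Disjoint P V) (d6 : Disjoint P V') (d7 : Disjoint P' V) (d8 : Disjoint P' V')
    (c d : ℝ) (hb : 4 * d < (μ.real (V ∩ S ⁻¹' P) - μ.real (V ∩ S ⁻¹' P') +
        μ.real (P ∩ S ⁻¹' V) - μ.real (P' ∩ S ⁻¹' V)) - (μ.real (V' ∩ S ⁻¹' P) -
        μ.real (V' ∩ S ⁻¹' P') + μ.real (P ∩ S ⁻¹' V') - μ.real (P' ∩ S ⁻¹' V'))) :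
    ∃ A B, (A = P ∨ A = P') ∧ (B = V ∨ B = V') ∧
      d < |μ.real ((R ∪ A ∪ B) ∩ S ⁻¹' (R ∪ A ∪ B)) - c| := by
  have hl : ∀ E F G : Set X, MeasurableSet F → MeasurableSet G → Disjoint E F →
      μ.real ((E ∪ F) ∩ S ⁻¹' G) = μ.real (E ∩ S ⁻¹' G) + μ.real (F ∩ S ⁻¹' G) := by
    intro E F G hF hG h
    rw [Set.union_inter_distrib_right, measureReal_union
      (h.mono Set.inter_subset_left Set.inter_subset_left) (hF.inter (hS hG))]
  have hr : ∀ E F G : Set X, MeasurableSet F → MeasurableSet G → Disjoint E F →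
      μ.real (G ∩ S ⁻¹' (E ∪ F)) = μ.real (G ∩ S ⁻¹' E) + μ.real (G ∩ S ⁻¹' F) := by
    intro E F G hF hG h
    rw [Set.preimage_union, Set.inter_union_distrib_left, measureReal_union
      ((h.preimage S).mono Set.inter_subset_right Set.inter_subset_right) (hG.inter (hS hF))]
  have hD : ∀ A B : Set X, MeasurableSet A → MeasurableSet B → Disjoint R A → Disjoint R B →
      Disjoint A B → μ.real ((R ∪ A ∪ B) ∩ S ⁻¹' (R ∪ A ∪ B)) =
      μ.real (R ∩ S ⁻¹' R) + μ.real (R ∩ S ⁻¹' A) + μ.real (R ∩ S ⁻¹' B) +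
      μ.real (A ∩ S ⁻¹' R) + μ.real (A ∩ S ⁻¹' A) + μ.real (A ∩ S ⁻¹' B) +
      μ.real (B ∩ S ⁻¹' R) + μ.real (B ∩ S ⁻¹' A) + μ.real (B ∩ S ⁻¹' B) := by
    intro A B hA hB h1 h2 h3
    have h4 : Disjoint (R ∪ A) B := h2.union_left h3
    have mD := (hR.union hA).union hB
    rw [hl _ _ _ hB mD h4, hl _ _ _ hA mD h1, hr _ _ _ hB hR h4, hr _ _ _ hB hA h4,
      hr _ _ _ hB hB h4, hr _ _ _ hA hR h1, hr _ _ _ hA hA h1, hr _ _ _ hA hB h1]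
    ring
  by_contra! hcon
  have a1 := abs_le.1 (hcon P V (Or.inl rfl) (Or.inl rfl))
  have a2 := abs_le.1 (hcon P V' (Or.inl rfl) (Or.inr rfl))
  have a3 := abs_le.1 (hcon P' V (Or.inr rfl) (Or.inl rfl))
  have a4 := abs_le.1 (hcon P' V' (Or.inr rfl) (Or.inr rfl))
  rw [hD P V hP hV d1 d3 d5] at a1
  rw [hD P V' hP hV' d1 d4 d6] at a2
  rw [hD P' V hP' hV d2 d3 d7] at a3
  rw [hD P' V' hP' hV' d2 d4 d8] at a4
  linarith [a1.2, a2.1, a3.1, a4.2]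

end part5


section part6

lemma aux_int_label {X : Type*} [MeasurableSpace X] (μ : Measure X) [IsProbabilityMeasure μ]
    {κ : Type*} [Fintype κ] (l : X → κ) (hl : ∀ J : Set κ, MeasurableSet (l ⁻¹' J))
    (g : X → ℝ) (hg : Integrable g μ)
    (E : Set X) (hE : MeasurableSet E) :
    ∫ x in E, g x ∂μ = ∑ a, ∫ x in E ∩ l ⁻¹' {a}, g x ∂μ := by
  have : E = ⋃ a, E ∩ l ⁻¹' {a} := by ext x; simp
  conv_lhs => rw [this]
  rw [integral_iUnion_fintype]
  · intro a
    exact hE.inter (hl _)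
  · intro a b hab
    rw [Function.onFun, Set.disjoint_left]
    rintro x ⟨_, h1⟩ ⟨_, h2⟩
    exact hab (h1.symm.trans h2)
  · intro a
    exact hg.integrableOn

lemma aux_swap_set {X : Type*} [MeasurableSpace X] (μ : Measure X) [IsProbabilityMeasure μ]
    (T : X ≃ᵐ X) (hT : MeasurePreserving T μ μ)
    (hmix : ∀ A B : Set X, MeasurableSet A → MeasurableSet B →
      Tendsto (fun n : ℕ => μ.real (A ∩ ((⇑T)^[n]) ⁻¹' B)) atTop
        (nhds (μ.real A * μ.real B)))
    {κ : Type*} [Fintype κ] (l : X → κ) (hl : ∀ J : Set κ, MeasurableSet (l ⁻¹' J))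
    (C D : Set X) (hC : MeasurableSet C) (hD : MeasurableSet D)
    (hlab : ∀ a, μ.real (C ∩ l ⁻¹' {a}) = μ.real (D ∩ l ⁻¹' {a})) :
    ∃ τ : X ≃ᵐ X, MeasurePreserving τ μ μ ∧ (∀ x, τ (τ x) = x) ∧ (∀ x, l (τ x) = l x) ∧
      ∀ n : ℕ, μ.real (τ ⁻¹' C ∩ (⇑T)^[n] ⁻¹' (τ ⁻¹' C)) = μ.real (D ∩ (⇑T)^[n] ⁻¹' D) := by
  have key : ∀ (C D : Set X) a, MeasurableSet C → MeasurableSet D →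
      μ.real (C \ D ∩ l ⁻¹' {a}) = μ.real (C ∩ l ⁻¹' {a}) - μ.real (C ∩ D ∩ l ⁻¹' {a}) := by
    intro C D a hC hD
    have h := measureReal_inter_add_sdiff (μ := μ) (s := C ∩ l ⁻¹' {a}) hD
    have e1 : C ∩ l ⁻¹' {a} ∩ D = C ∩ D ∩ l ⁻¹' {a} := by ext x; simp; tauto
    have e2 : (C ∩ l ⁻¹' {a}) \ D = C \ D ∩ l ⁻¹' {a} := by ext x; simp; tauto
    rw [e1, e2] at h
    linarith
  obtain ⟨τ, h1, h2, h3, h4, h5, h6⟩ := aux_swap μ T hT hmix l hl (C \ D) (D \ C) (hC.diff hD)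
    (hD.diff hC) (Set.disjoint_left.2 fun x h h' => h.2 h'.1) (by
      intro a
      rw [key C D a hC hD, key D C a hD hC, hlab a, Set.inter_comm C D])
  refine ⟨τ, h1, h2, h3, fun n => ?_⟩
  have hae : τ ⁻¹' C =ᵐ[μ] D := by
    filter_upwards [h5, h6] with x h5 h6
    refine propext ?_
    change τ x ∈ C ↔ x ∈ D
    have h4 := h4 x
    by_cases hc : x ∈ C <;> by_cases hd : x ∈ D
    · simp [h4, hc, hd]
    · have := h5 ⟨hc, hd⟩
      simp [hd, this.2]
    · have := h6 ⟨hd, hc⟩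
      simp [hd, this.1]
    · simp [h4, hc, hd]
  refine measureReal_congr ?_
  exact hae.inter ((hT.iterate n).quasiMeasurePreserving.preimage_ae_eq hae)

lemma aux_step {X : Type*} [MeasurableSpace X] [StandardBorelSpace X]
    (μ : Measure X) [IsProbabilityMeasure μ] (hna : ∀ x, μ {x} = 0)
    (T : X ≃ᵐ X) (hT : MeasurePreserving T μ μ)
    (hmix : ∀ A B : Set X, MeasurableSet A → MeasurableSet B →
      Tendsto (fun n : ℕ => μ.real (A ∩ ((⇑T)^[n]) ⁻¹' B)) atTop
        (nhds (μ.real A * μ.real B)))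
    {κ : Type*} [Fintype κ] (l : X → κ) (hl : ∀ J : Set κ, MeasurableSet (l ⁻¹' J))
    (C : Set X) (hC : MeasurableSet C) (y : ℝ) (hy : 0 < y)
    (hCy : ∀ J : Set κ, y ≤ μ.real (symmDiff C (l ⁻¹' J))) (N : ℕ) :
    ∃ n ≥ N, ∃ τ : X ≃ᵐ X, MeasurePreserving τ μ μ ∧ (∀ x, τ (τ x) = x) ∧ (∀ x, l (τ x) = l x) ∧
      y ^ 2 / 32 < |μ.real (τ ⁻¹' C ∩ (⇑T)^[n] ⁻¹' (τ ⁻¹' C)) - μ.real C ^ 2| := by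
  classical
  let m : Set X → κ → ℝ := fun E a => μ.real (E ∩ l ⁻¹' {a})
  have mm : ∀ E a, m E a = μ.real (E ∩ l ⁻¹' {a}) := fun _ _ => rfl
  have m0 : ∀ E a, 0 ≤ m E a := fun E a => measureReal_nonneg
  have mU : ∀ E F a, MeasurableSet F → Disjoint E F → m (E ∪ F) a = m E a + m F a := by
    intro E F a hF h
    simp only [m]
    rw [Set.union_inter_distrib_right, measureReal_union
      (h.mono Set.inter_subset_left Set.inter_subset_left) (hF.inter (hl _))]
  have mD : ∀ E F a, MeasurableSet F → F ⊆ E → m (E \ F) a = m E a - m F a := by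
    intro E F a hF h
    have := mU (E \ F) F a hF Set.disjoint_sdiff_left
    rw [Set.sdiff_union_of_subset h] at this
    linarith
  have mS : ∀ E, MeasurableSet E → μ.real E = ∑ a, m E a := fun E hE => aux_sum_label μ l hl E hE
  let r : κ → ℝ := fun a => min (m C a) (m Cᶜ a)
  have r0 : ∀ a, 0 ≤ r a := fun a => le_min (m0 _ _) (m0 _ _)
  have r1 : ∀ a, r a ≤ m C a := fun a => min_le_left _ _
  have r2 : ∀ a, r a ≤ m Cᶜ a := fun a => min_le_right _ _
  set ρ := ∑ a, r a with hρ
  have hyρ : y ≤ ρ := by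
    refine (hCy {a | m Cᶜ a < m C a}).trans ?_
    rw [mS _ (hC.symmDiff (hl _))]
    refine Finset.sum_le_sum fun a _ => ?_
    by_cases h : m Cᶜ a < m C a
    · have : symmDiff C (l ⁻¹' {a | m Cᶜ a < m C a}) ∩ l ⁻¹' {a} = Cᶜ ∩ l ⁻¹' {a} := by
        ext x
        simp only [Set.mem_inter_iff, Set.mem_symmDiff, Set.mem_preimage, Set.mem_singleton_iff,
          Set.mem_compl_iff]
        refine and_congr_left fun hx => ?_
        rw [hx]
        have : a ∈ {a | m Cᶜ a < m C a} := h
        tauto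
      change μ.real _ ≤ r a
      rw [this]
      exact le_min h.le le_rfl
    · have : symmDiff C (l ⁻¹' {a | m Cᶜ a < m C a}) ∩ l ⁻¹' {a} = C ∩ l ⁻¹' {a} := by
        ext x
        simp only [Set.mem_inter_iff, Set.mem_symmDiff, Set.mem_preimage, Set.mem_singleton_iff]
        refine and_congr_left fun hx => ?_
        rw [hx]
        have : a ∉ {a | m Cᶜ a < m C a} := h
        tauto
      change μ.real _ ≤ r a
      rw [this]
      exact le_min le_rfl (not_lt.1 h)
  obtain ⟨P, hPC, hP, hPm⟩ := aux_split_label μ hna l hl C hC (fun a => r a / 4)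
    (fun a => by have := r0 a; positivity) (fun a => by have := r0 a; have := r1 a; rw [← mm]; linarith)
  obtain ⟨P', hPC', hP', hPm'⟩ := aux_split_label μ hna l hl Cᶜ hC.compl (fun a => r a / 4)
    (fun a => by have := r0 a; positivity) (fun a => by have := r0 a; have := r2 a; rw [← mm]; linarith)
  simp only [← mm] at hPm hPm'
  obtain ⟨Q, hQC, hQ, hQm⟩ := aux_split_label μ hna l hl (C \ P) (hC.diff hP) (fun a => 3 * r a / 4)
    (fun a => by have := r0 a; positivity) (fun a => by
      rw [← mm, mD _ _ _ hP hPC, hPm]; have := r1 a; linarith)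
  obtain ⟨Q', hQC', hQ', hQm'⟩ := aux_split_label μ hna l hl (Cᶜ \ P') (hC.compl.diff hP')
    (fun a => 3 * r a / 4)
    (fun a => by have := r0 a; positivity) (fun a => by
      rw [← mm, mD _ _ _ hP' hPC', hPm']; have := r2 a; linarith)
  simp only [← mm] at hQm hQm'
  have dPP : Disjoint P P' := Set.disjoint_left.2 fun x h h' => hPC' h' (hPC h)
  have dQQ : Disjoint Q Q' := Set.disjoint_left.2 fun x h h' => (hQC' h').1 (hQC h).1
  set Z := Q ∪ Q' with hZdef
  have hZ : MeasurableSet Z := hQ.union hQ'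
  have dPZ : Disjoint P Z := by
    rw [Set.disjoint_left]
    rintro x h (h' | h')
    · exact (hQC h').2 h
    · exact (hQC' h').1 (hPC h)
  have dPZ' : Disjoint P' Z := by
    rw [Set.disjoint_left]
    rintro x h (h' | h')
    · exact hPC' h (hQC h').1
    · exact (hQC' h').2 h
  have hZm : ∀ a, m Z a = 3 * r a / 2 := fun a => by
    rw [mU _ _ _ hQ' dQQ, hQm, hQm']; ring
  have eP : μ.real P = ρ / 4 := by rw [mS _ hP, hρ, Finset.sum_div]; simp only [hPm]
  have eP' : μ.real P' = ρ / 4 := by rw [mS _ hP', hρ, Finset.sum_div]; simp only [hPm']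
  have eZ : μ.real Z = 3 * ρ / 2 := by
    rw [mS _ hZ, hρ, Finset.mul_sum, Finset.sum_div]; simp only [hZm]
  have eY : μ.real (P ∪ P') = ρ / 2 := by rw [measureReal_union dPP hP', eP, eP']; ring
  set q : ℕ → Set X → Set X → ℝ := fun n A B => μ.real (A ∩ (⇑T)^[n] ⁻¹' B) with hq
  let c : ℕ → Set X → ℝ := fun n V => q n V P - q n V P' + q n P V - q n P' V
  have hc0 : ∀ V, MeasurableSet V → Tendsto (fun n => c n V) atTop (nhds 0) := by
    intro V hV
    have := (((hmix V P hV hP).sub (hmix V P' hV hP')).add (hmix P V hP hV)).sub (hmix P' V hP' hV)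
    rw [eP, eP'] at this
    convert this using 2
    ring
  have hA : ∀ a, MeasurableSet (Z ∩ l ⁻¹' {a}) := fun a => hZ.inter (hl _)
  have hLn : Tendsto (fun n => q n Z (P ∪ P') - q (2 * n) (P ∪ P') (P ∪ P') -
      ∑ a, |c n (Z ∩ l ⁻¹' {a})|) atTop (nhds (ρ ^ 2 / 2)) := by
    have t1 := hmix Z (P ∪ P') hZ (hP.union hP')
    have t2 := (hmix (P ∪ P') (P ∪ P') (hP.union hP') (hP.union hP')).comp
      (tendsto_id.const_mul_atTop' (show 0 < 2 by norm_num))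
    have t3 := tendsto_finsetSum (Finset.univ : Finset κ) fun a _ => (hc0 _ (hA a)).abs
    have := (t1.sub t2).sub t3
    rw [eZ, eY] at this
    simp only [abs_zero, Finset.sum_const_zero, sub_zero] at this
    have e : ρ ^ 2 / 2 = 3 * ρ / 2 * (ρ / 2) - ρ / 2 * (ρ / 2) := by ring
    rw [e]
    exact this
  have hlt : y ^ 2 / 4 < ρ ^ 2 / 2 := by
    have : y ^ 2 ≤ ρ ^ 2 := by gcongr
    have : 0 < y ^ 2 := by positivity
    linarith
  obtain ⟨n, hLn, hnN⟩ := ((hLn.eventually (lt_mem_nhds hlt)).and (eventually_ge_atTop N)).exists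
  refine ⟨n, hnN, ?_⟩
  obtain ⟨g, hg, hgi, hg2, hgint, hgZ⟩ := aux_g μ T hT n P P' hP hP' dPP
  have hgI : Integrable g μ := Integrable.of_bound hg.aestronglyMeasurable 2
    (Filter.Eventually.of_forall fun x => by simpa using hg2 x)
  choose V hVZ hV hVm hVi using fun a => aux_median μ hna (Z ∩ l ⁻¹' {a}) (hA a) g hg hgi hg2
  set W := ⋃ a, V a with hW
  have hWm : MeasurableSet W := MeasurableSet.iUnion hV
  have hWZ : W ⊆ Z := Set.iUnion_subset fun a => (hVZ a).trans Set.inter_subset_left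
  have hWa : ∀ a, W ∩ l ⁻¹' {a} = V a := by
    intro a
    ext x
    simp only [hW, Set.mem_inter_iff, Set.mem_iUnion, Set.mem_preimage, Set.mem_singleton_iff]
    constructor
    · rintro ⟨⟨b, hb⟩, rfl⟩
      have := (hVZ b hb).2
      simp only [Set.mem_preimage, Set.mem_singleton_iff] at this
      rw [this]; exact hb
    · intro h
      exact ⟨⟨a, h⟩, (hVZ a h).2⟩
  have hWa' : ∀ a, (Z \ W) ∩ l ⁻¹' {a} = (Z ∩ l ⁻¹' {a}) \ V a := by
    intro a
    rw [← hWa a]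
    ext x; simp; tauto
  have hWma : ∀ a, m W a = 3 * r a / 4 := by
    intro a
    rw [mm, hWa, hVm, ← mm, hZm]; ring
  have hWma' : ∀ a, m (Z \ W) a = 3 * r a / 4 := by
    intro a
    rw [mD _ _ _ hWm hWZ, hWma, hZm]; ring
  have hb : y ^ 2 / 8 < c n W - c n (Z \ W) := by
    have i1 := aux_int_label μ l hl g hgI W hWm
    have i2 := aux_int_label μ l hl g hgI (Z \ W) (hZ.diff hWm)
    have i3 := aux_int_label μ l hl (fun x => |g x|) hgI.abs Z hZ
    simp only [hWa] at i1
    simp only [hWa'] at i2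
    rw [hgint _ hWm] at i1
    rw [hgint _ (hZ.diff hWm)] at i2
    have i4 := hgZ Z hZ
    have i5 := Finset.sum_le_sum fun a (_ : a ∈ Finset.univ) => hVi a
    rw [← i3, Finset.sum_add_distrib, ← Finset.mul_sum, Finset.sum_sub_distrib, ← i1, ← i2] at i5
    have i6 : ∀ a, ∫ x in Z ∩ l ⁻¹' {a}, g x ∂μ = c n (Z ∩ l ⁻¹' {a}) := fun a => hgint _ (hA a)
    simp only [i6] at i5
    have i7 : ∫ x in Z, |g x| ∂μ ≤ 2 * (c n W - c n (Z \ W)) + ∑ a, |c n (Z ∩ l ⁻¹' {a})| := i5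
    have i8 : q n Z (P ∪ P') - q (2 * n) (P ∪ P') (P ∪ P') ≤ ∫ x in Z, |g x| ∂μ := i4
    linarith
  set R := C \ (P ∪ Q) with hR
  have hRm : MeasurableSet R := hC.diff (hP.union hQ)
  have dRP : Disjoint R P := Set.disjoint_left.2 fun x h h' => h.2 (Or.inl h')
  have dRP' : Disjoint R P' := Set.disjoint_left.2 fun x h h' => hPC' h' h.1
  have dRZ : Disjoint R Z := by
    rw [Set.disjoint_left]
    rintro x h (h' | h')
    · exact h.2 (Or.inr h')
    · exact (hQC' h').1 h.1
  obtain ⟨A, B, hA', hB', hAB⟩ := aux_polar μ (⇑T)^[n] (hT.iterate n).measurable R P P' W (Z \ W)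
    hRm hP hP' hWm (hZ.diff hWm) dRP dRP' (dRZ.mono_right hWZ) (dRZ.mono_right Set.sdiff_subset)
    (dPZ.mono_right hWZ) (dPZ.mono_right Set.sdiff_subset)
    (dPZ'.mono_right hWZ) (dPZ'.mono_right Set.sdiff_subset) (μ.real C ^ 2) (y ^ 2 / 32)
    (lt_of_eq_of_lt (by ring) hb)
  have pA : MeasurableSet A ∧ Disjoint R A ∧ Disjoint A Z ∧ ∀ a, m A a = r a / 4 := by
    rcases hA' with rfl | rfl
    · exact ⟨hP, dRP, dPZ, hPm⟩
    · exact ⟨hP', dRP', dPZ', hPm'⟩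
  have pB : MeasurableSet B ∧ B ⊆ Z ∧ ∀ a, m B a = 3 * r a / 4 := by
    rcases hB' with rfl | rfl
    · exact ⟨hWm, hWZ, hWma⟩
    · exact ⟨hZ.diff hWm, Set.sdiff_subset, hWma'⟩
  obtain ⟨τ, t1, t2, t3, t4⟩ := aux_swap_set μ T hT hmix l hl C (R ∪ A ∪ B) hC
    ((hRm.union pA.1).union pB.1) (by
      intro a
      rw [← mm, ← mm, mU _ _ _ pB.1 ((dRZ.mono_right pB.2.1).union_left
        (pA.2.2.1.mono_right pB.2.1)), mU _ _ _ pA.1 pA.2.1, pA.2.2.2, pB.2.2, hR,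
        mD _ _ _ (hP.union hQ) (Set.union_subset hPC (hQC.trans Set.sdiff_subset)),
        mU _ _ _ hQ (dPZ.mono_right Set.subset_union_left), hPm, hQm]
      ring)
  refine ⟨τ, t1, t2, t3, ?_⟩
  rw [t4]
  exact hAB

end part6


section part7

noncomputable abbrev auxI {X : Type*} [MeasurableSpace X] (μ : Measure X) [IsFiniteMeasure μ]
    {A : Set X} (hA : MeasurableSet A) : Lp ℝ 1 μ :=
  indicatorConstLp 1 hA (measure_ne_top μ _) (1 : ℝ)

lemma auxI_dist {X : Type*} [MeasurableSpace X] (μ : Measure X) [IsProbabilityMeasure μ]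
    {A B : Set X} (hA : MeasurableSet A) (hB : MeasurableSet B) :
    dist (auxI μ hA) (auxI μ hB) = μ.real (symmDiff A B) := by
  rw [dist_indicatorConstLp_eq_norm, norm_indicatorConstLp (by simp) (by simp)]
  simp

lemma auxI_lim {X : Type*} [MeasurableSpace X] (μ : Measure X) [IsProbabilityMeasure μ]
    (M : ℕ → Set X) (hM : ∀ r, MeasurableSet (M r)) (h : Lp ℝ 1 μ)
    (hlim : Tendsto (fun r => auxI μ (hM r)) atTop (nhds h)) :
    ∃ F, ∃ hF : MeasurableSet F, h = auxI μ hF ∧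
      Tendsto (fun r => μ.real (symmDiff (M r) F)) atTop (nhds 0) := by
  obtain ⟨ns, hns, hae⟩ := (tendstoInMeasure_of_tendsto_Lp hlim).exists_seq_tendsto_ae
  have hF : MeasurableSet (⇑h ⁻¹' {1}) := (Lp.stronglyMeasurable h).measurable (measurableSet_singleton 1)
  have hc : ∀ᵐ x ∂μ, ∀ r, auxI μ (hM r) x = (M r).indicator (fun _ => (1:ℝ)) x :=
    ae_all_iff.2 fun r => indicatorConstLp_coeFn
  have h1 : h = auxI μ hF := by
    refine Lp.ext ?_
    filter_upwards [hae, hc, (indicatorConstLp_coeFn (p := 1) (hs := hF) (hμs := measure_ne_top μ _)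
      (c := (1:ℝ)))] with x h1 h2 h3
    rw [h3]
    have hcl : IsClosed ({0, 1} : Set ℝ) := (Set.toFinite _).isClosed
    have hmem : h x ∈ ({0, 1} : Set ℝ) := by
      refine hcl.mem_of_tendsto h1 (Filter.Eventually.of_forall fun r => ?_)
      rw [h2]
      by_cases hx : x ∈ M (ns r) <;> simp [hx]
    by_cases hx : x ∈ ⇑h ⁻¹' {1}
    · rw [Set.indicator_of_mem hx]; exact hx
    · rw [Set.indicator_of_notMem hx]
      rcases hmem with h | h
      · exact h
      · exact absurd h hx
  refine ⟨_, hF, h1, ?_⟩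
  have := tendsto_iff_dist_tendsto_zero.1 hlim
  rw [h1] at this
  simpa only [auxI_dist] using this

lemma aux_law {X : Type*} [MeasurableSpace X] (μ : Measure X) [IsProbabilityMeasure μ]
    {ι : Type*} (V W : ι → Set X) (hV : ∀ i, MeasurableSet (V i)) (hW : ∀ i, MeasurableSet (W i))
    (Vr Wr : ℕ → ι → Set X) (hVr : ∀ r i, MeasurableSet (Vr r i))
    (hWr : ∀ r i, MeasurableSet (Wr r i))
    (lV : ∀ i, Tendsto (fun r => μ.real (symmDiff (Vr r i) (V i))) atTop (nhds 0))
    (lW : ∀ i, Tendsto (fun r => μ.real (symmDiff (Wr r i) (W i))) atTop (nhds 0))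
    (heq : ∀ r (F : Finset ι), μ.real (⋂ i ∈ F, Vr r i) = μ.real (⋂ i ∈ F, Wr r i)) :
    μ.map (fun x i => x ∈ V i) = μ.map (fun x i => x ∈ W i) := by
  classical
  have mm : ∀ V : ι → Set X, (∀ i, MeasurableSet (V i)) → Measurable (fun x i => x ∈ V i) := by
    intro V hV
    exact measurable_pi_iff.2 fun i => measurable_mem.2 (hV i)
  have key : ∀ (V : ι → Set X) (Vr : ℕ → ι → Set X), (∀ i, MeasurableSet (V i)) →
      (∀ r i, MeasurableSet (Vr r i)) →
      (∀ i, Tendsto (fun r => μ.real (symmDiff (Vr r i) (V i))) atTop (nhds 0)) →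
      ∀ F : Finset ι, Tendsto (fun r => μ.real (⋂ i ∈ F, Vr r i)) atTop
        (nhds (μ.real (⋂ i ∈ F, V i))) := by
    intro V Vr hV hVr lV F
    rw [tendsto_iff_dist_tendsto_zero]
    have hs := tendsto_finsetSum F fun i _ => lV i
    rw [Finset.sum_const_zero] at hs
    refine squeeze_zero (fun _ => dist_nonneg) (fun r => ?_) hs
    rw [Real.dist_eq]
    refine (abs_measureReal_sub_le_measureReal_symmDiff
      (MeasurableSet.biInter F.countable_toSet fun i _ => hVr r i).nullMeasurableSet
      (MeasurableSet.biInter F.countable_toSet fun i _ => hV i).nullMeasurableSet).trans ?_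
    refine le_trans (measureReal_mono ?_ (measure_ne_top _ _)) (measureReal_biUnion_finset_le F _)
    intro x hx
    simp only [Set.mem_symmDiff, Set.mem_iInter, Set.mem_iUnion] at hx ⊢
    by_contra! hcon
    rcases hx with ⟨h1, h2⟩ | ⟨h1, h2⟩
    · exact h2 fun i hi => (hcon i hi).1 (h1 i hi)
    · exact h2 fun i hi => (hcon i hi).2 (h1 i hi)
  have hlim : ∀ F : Finset ι, μ.real (⋂ i ∈ F, V i) = μ.real (⋂ i ∈ F, W i) := by
    intro F
    refine tendsto_nhds_unique (key V Vr hV hVr lV F) ?_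
    simp only [heq]
    exact key W Wr hW hWr lW F
  have := Measure.isProbabilityMeasure_map (mm V hV).aemeasurable (μ := μ)
  have := Measure.isProbabilityMeasure_map (mm W hW).aemeasurable (μ := μ)
  let 𝒦 : Set (Set (ι → Prop)) := {S | ∃ F : Finset ι, S = ⋂ i ∈ F, {p | p i}}
  have hmk : ∀ i : ι, MeasurableSet {p : ι → Prop | p i} := fun i =>
    measurableSet_setOfPred.2 (measurable_pi_apply i)
  refine ext_of_generate_finite 𝒦 ?_ ?_ ?_ (by simp)
  · refine le_antisymm ?_ ?_
    · refine iSup_le fun i => ?_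
      rw [← measurable_iff_comap_le]
      refine @measurable_to_prop _ (MeasurableSpace.generateFrom 𝒦) _ ?_
      refine MeasurableSpace.measurableSet_generateFrom ⟨{i}, ?_⟩
      ext p; simp
    · refine MeasurableSpace.generateFrom_le ?_
      rintro S ⟨F, rfl⟩
      exact MeasurableSet.biInter F.countable_toSet fun i _ => hmk i
  · rintro S ⟨F, rfl⟩ S' ⟨F', rfl⟩ _
    refine ⟨F ∪ F', ?_⟩
    ext p; simp [or_imp, forall_and]
  · rintro S ⟨F, rfl⟩
    have hS : MeasurableSet (⋂ i ∈ F, {p : ι → Prop | p i}) :=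
      MeasurableSet.biInter F.countable_toSet fun i _ => hmk i
    rw [Measure.map_apply (mm V hV) hS, Measure.map_apply (mm W hW) hS]
    have e : ∀ V : ι → Set X, (fun x i => x ∈ V i) ⁻¹' (⋂ i ∈ F, {p : ι → Prop | p i}) =
        ⋂ i ∈ F, V i := by
      intro V
      ext x; simp
    rw [e, e]
    have := hlim F
    rwa [measureReal_def, measureReal_def, ENNReal.toReal_eq_toReal_iff' (measure_ne_top _ _)
      (measure_ne_top _ _)] at this

lemma aux_null_unc {X : Type*} [MeasurableSpace X] [StandardBorelSpace X]
    (μ : Measure X) [IsProbabilityMeasure μ] (hna : ∀ x, μ {x} = 0) :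
    ∃ N : Set X, MeasurableSet N ∧ μ N = 0 ∧ ¬ N.Countable := by
  have hX : ¬ Countable X := by
    intro h
    have h1 : μ Set.univ = 0 := by
      rw [← Set.biUnion_of_singleton (Set.univ : Set X)]
      exact (measure_biUnion_null_iff Set.countable_univ).2 fun x _ => hna x
    simp at h1
  have hR : ¬ Countable (ℝ × ℝ) := by
    intro h
    have : Function.Injective (fun x : ℝ => (x, (0:ℝ))) := fun a b h => by simpa using h
    have h2 : Countable ℝ := this.countable
    exact not_countable h2
  let k : X ≃ᵐ ℝ × ℝ := PolishSpace.measurableEquivOfNotCountable hX hR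
  let A : ℝ → Set X := fun a => (fun x => (k x).1) ⁻¹' {a}
  have hA : ∀ a, MeasurableSet (A a) := fun a =>
    (measurable_fst.comp k.measurable) (measurableSet_singleton a)
  have hc := Measure.countable_meas_pos_of_disjoint_iUnion (μ := μ) hA (by
    intro a b hab
    rw [Function.onFun, Set.disjoint_left]
    intro x h1 h2
    exact hab (h1.symm.trans h2))
  obtain ⟨a, ha⟩ : ∃ a, a ∉ {i | 0 < μ (A i)} := by
    by_contra! hcon
    rw [Set.eq_univ_of_forall hcon] at hc
    exact Set.not_countable_univ hc
  refine ⟨A a, hA a, le_antisymm (not_lt.1 ha) zero_le, fun h => ?_⟩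
  have : Function.Injective (fun t : ℝ => k.symm (a, t)) := fun s t h => by simpa using h
  have h2 : (Set.univ : Set ℝ).Countable := by
    refine Set.Countable.mono (s₂ := (fun t : ℝ => k.symm (a, t)) ⁻¹' (A a)) ?_
      (h.preimage this)
    intro t _
    simp [A]
  exact Set.not_countable_univ h2

lemma aux_fix {X : Type*} [MeasurableSpace X] [StandardBorelSpace X]
    (μ : Measure X) [IsProbabilityMeasure μ] (hna : ∀ x, μ {x} = 0)
    (φ γ : X → X) (hφ : MeasurePreserving φ μ μ) (hγ : MeasurePreserving γ μ μ)
    (h1 : ∀ᵐ x ∂μ, γ (φ x) = x) (h2 : ∀ᵐ x ∂μ, φ (γ x) = x) :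
    ∃ ψ : MPE μ, ψ.1 =ᵐ[μ] φ ∧ ψ.1.symm =ᵐ[μ] γ := by
  classical
  obtain ⟨N, hN, hN0, hNc⟩ := aux_null_unc μ hna
  let X1 : Set X := {x | γ (φ x) = x} ∩ Nᶜ ∩ φ ⁻¹' Nᶜ
  let Y1 : Set X := {x | φ (γ x) = x} ∩ Nᶜ ∩ γ ⁻¹' Nᶜ
  have mX : MeasurableSet X1 := ((measurableSet_eq_fun (hγ.measurable.comp hφ.measurable)
    measurable_id).inter hN.compl).inter (hφ.measurable hN.compl)
  have mY : MeasurableSet Y1 := ((measurableSet_eq_fun (hφ.measurable.comp hγ.measurable)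
    measurable_id).inter hN.compl).inter (hγ.measurable hN.compl)
  have hNae : ∀ᵐ x ∂μ, x ∈ Nᶜ := compl_mem_ae_iff.2 hN0
  have aX : ∀ᵐ x ∂μ, x ∈ X1 := by
    filter_upwards [h1, hNae, hφ.quasiMeasurePreserving.ae hNae] with x a b c
    exact ⟨⟨a, b⟩, c⟩
  have aY : ∀ᵐ x ∂μ, x ∈ Y1 := by
    filter_upwards [h2, hNae, hγ.quasiMeasurePreserving.ae hNae] with x a b c
    exact ⟨⟨a, b⟩, c⟩
  have XY : ∀ x ∈ X1, φ x ∈ Y1 := by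
    rintro x ⟨⟨a, b⟩, c⟩
    have a' : γ (φ x) = x := a
    refine ⟨⟨?_, c⟩, ?_⟩
    · change φ (γ (φ x)) = φ x
      rw [a']
    · change γ (φ x) ∈ Nᶜ
      rw [a']; exact b
  have YX : ∀ x ∈ Y1, γ x ∈ X1 := by
    rintro x ⟨⟨a, b⟩, c⟩
    have a' : φ (γ x) = x := a
    refine ⟨⟨?_, c⟩, ?_⟩
    · change γ (φ (γ x)) = γ x
      rw [a']
    · change φ (γ x) ∈ Nᶜ
      rw [a']; exact b
  let e1 : X1 ≃ᵐ Y1 :=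
    { toFun := fun x => ⟨φ x, XY x x.2⟩
      invFun := fun x => ⟨γ x, YX x x.2⟩
      left_inv := fun x => Subtype.ext x.2.1.1
      right_inv := fun x => Subtype.ext x.2.1.1
      measurable_toFun := (hφ.measurable.comp measurable_subtype_coe).subtype_mk
      measurable_invFun := (hγ.measurable.comp measurable_subtype_coe).subtype_mk }
  have := mX.compl.standardBorel
  have := mY.compl.standardBorel
  have cX : ¬ Countable (X1ᶜ : Set X) := fun h =>
    hNc (Set.Countable.mono (fun x hx (h : x ∈ X1) => h.1.2 hx) (Set.countable_coe_iff.1 h))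
  have cY : ¬ Countable (Y1ᶜ : Set X) := fun h =>
    hNc (Set.Countable.mono (fun x hx (h : x ∈ Y1) => h.1.2 hx) (Set.countable_coe_iff.1 h))
  let e2 : (X1ᶜ : Set X) ≃ᵐ (Y1ᶜ : Set X) := PolishSpace.measurableEquivOfNotCountable cX cY
  let ψ : X ≃ᵐ X := (MeasurableEquiv.sumCompl mX).symm.trans
    ((MeasurableEquiv.sumCongr e1 e2).trans (MeasurableEquiv.sumCompl mY))
  have p1 : ∀ x ∈ X1, ψ x = φ x := by
    intro x hx
    have : (MeasurableEquiv.sumCompl mX).symm x = Sum.inl ⟨x, hx⟩ := by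
      rw [MeasurableEquiv.symm_apply_eq]; rfl
    change (MeasurableEquiv.sumCompl mY) ((MeasurableEquiv.sumCongr e1 e2)
      ((MeasurableEquiv.sumCompl mX).symm x)) = _
    rw [this]
    rfl
  have p2 : ∀ x ∈ Y1, ψ.symm x = γ x := by
    intro x hx
    rw [MeasurableEquiv.symm_apply_eq, p1 _ (YX x hx)]
    exact hx.1.1.symm
  have q1 : ψ =ᵐ[μ] φ := aX.mono p1
  have q2 : ψ.symm =ᵐ[μ] γ := aY.mono p2
  refine ⟨⟨ψ, ψ.measurable, ?_⟩, q1, q2⟩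
  rw [Measure.map_congr q1, hφ.map_eq]

end part7


section part8

/-- completeness: the limit of a sequence of automorphisms in the strong sense -/
lemma aux_complete {X : Type*} [MeasurableSpace X] [StandardBorelSpace X]
    (μ : Measure X) [IsProbabilityMeasure μ] (hna : ∀ x, μ {x} = 0)
    (𝒜 : Set (Set X)) (h𝒜c : 𝒜.Countable) (h𝒜m : ∀ A ∈ 𝒜, MeasurableSet A)
    (h𝒜s : ∀ x y, (∀ A ∈ 𝒜, x ∈ A ↔ y ∈ A) → x = y)
    (φ : ℕ → MPE μ) (E F : 𝒜 → Set X) (hE : ∀ A, MeasurableSet (E A))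
    (hF : ∀ A, MeasurableSet (F A))
    (lE : ∀ A : 𝒜, Tendsto (fun r => μ.real (symmDiff ((φ r).1.symm ⁻¹' A) (E A))) atTop (nhds 0))
    (lF : ∀ A : 𝒜, Tendsto (fun r => μ.real (symmDiff ((φ r).1 ⁻¹' A) (F A))) atTop (nhds 0)) :
    ∃ ψ : MPE μ, ∀ A : 𝒜, ψ.1.symm ⁻¹' A =ᵐ[μ] E A ∧ ψ.1 ⁻¹' A =ᵐ[μ] F A := by
  classical
  have : Countable 𝒜 := h𝒜c.to_subtype
  have hne : Nonempty X := by
    by_contra h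
    rw [not_nonempty_iff] at h
    have h1 : μ Set.univ = 1 := measure_univ
    rw [Set.univ_eq_empty_iff.2 h] at h1
    simp at h1
  let V : 𝒜 ⊕ 𝒜 → Set X := Sum.elim (fun A => (A : Set X)) F
  let W : 𝒜 ⊕ 𝒜 → Set X := Sum.elim E (fun A => (A : Set X))
  let Vr : ℕ → 𝒜 ⊕ 𝒜 → Set X := fun r => Sum.elim (fun A => (A : Set X)) (fun A => (φ r).1 ⁻¹' A)
  let Wr : ℕ → 𝒜 ⊕ 𝒜 → Set X :=
    fun r => Sum.elim (fun A => (φ r).1.symm ⁻¹' A) (fun A => (A : Set X))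
  have hlaw := aux_law μ V W
    (by rintro (A | A); exacts [h𝒜m A A.2, hF A])
    (by rintro (A | A); exacts [hE A, h𝒜m A A.2]) Vr Wr
    (by rintro r (A | A); exacts [h𝒜m A A.2, (φ r).1.measurable (h𝒜m A A.2)])
    (by rintro r (A | A); exacts [(φ r).1.symm.measurable (h𝒜m A A.2), h𝒜m A A.2])
    (by
      rintro (A | A)
      · simp [V, Vr]
      · exact lF A)
    (by
      rintro (A | A)
      · exact lE A
      · simp [W, Wr])
    (by
      intro r G
      have hm : MeasurableSet (⋂ i ∈ G, Wr r i) := by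
        refine MeasurableSet.biInter G.countable_toSet ?_
        rintro (A | A) _
        exacts [(φ r).1.symm.measurable (h𝒜m A A.2), h𝒜m A A.2]
      rw [measureReal_def, measureReal_def, ← (φ r).2.measure_preimage hm.nullMeasurableSet]
      congr 2
      ext x
      simp only [Set.mem_iInter, Set.mem_preimage]
      refine forall_congr' fun i => forall_congr' fun _ => ?_
      rcases i with A | A
      · simp [Vr, Wr]
      · simp [Vr, Wr])
  let K := 𝒜 → Prop
  let J : X → K := fun x A => x ∈ (A : Set X)
  let g : X → K := fun x A => x ∈ F A
  let f : X → K := fun x A => x ∈ E A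
  have mJ : Measurable J := measurable_pi_iff.2 fun A => measurable_mem.2 (h𝒜m A A.2)
  have mg : Measurable g := measurable_pi_iff.2 fun A => measurable_mem.2 (hF A)
  have mf : Measurable f := measurable_pi_iff.2 fun A => measurable_mem.2 (hE A)
  have iJ : Function.Injective J := by
    intro x y hxy
    refine h𝒜s x y fun A hA => ?_
    exact iff_of_eq (congrFun hxy ⟨A, hA⟩)
  have eJ : MeasurableEmbedding J := mJ.measurableEmbedding iJ
  obtain ⟨r, mr, hr⟩ := eJ.exists_measurable_extend measurable_id fun _ => hne
  have hr' : ∀ x, r (J x) = x := fun x => congrFun hr x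
  -- transfer
  have tr : ∀ S : Set (K × K), MeasurableSet S →
      μ {x | (J x, g x) ∈ S} = μ {x | (f x, J x) ∈ S} := by
    intro S hS
    let pr : (𝒜 ⊕ 𝒜 → Prop) → K × K := fun p => (fun A => p (Sum.inl A), fun A => p (Sum.inr A))
    have mpr : Measurable pr :=
      (measurable_pi_iff.2 fun A => measurable_pi_apply _).prodMk
        (measurable_pi_iff.2 fun A => measurable_pi_apply _)
    have mV : Measurable (fun x i => x ∈ V i) := by
      refine measurable_pi_iff.2 ?_
      rintro (A | A)
      exacts [measurable_mem.2 (h𝒜m A A.2), measurable_mem.2 (hF A)]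
    have mW : Measurable (fun x i => x ∈ W i) := by
      refine measurable_pi_iff.2 ?_
      rintro (A | A)
      exacts [measurable_mem.2 (hE A), measurable_mem.2 (h𝒜m A A.2)]
    have := congrArg (fun ν => ν (pr ⁻¹' S)) hlaw
    rw [Measure.map_apply mV (mpr hS), Measure.map_apply mW (mpr hS)] at this
    exact this
  have trae : ∀ S : Set (K × K), MeasurableSet S →
      ((∀ᵐ x ∂μ, (J x, g x) ∈ S) ↔ ∀ᵐ x ∂μ, (f x, J x) ∈ S) := by
    intro S hS
    have := tr Sᶜ hS.compl
    rw [ae_iff, ae_iff]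
    exact Eq.congr_left this
  have gR : ∀ᵐ x ∂μ, J (r (g x)) = g x := by
    have hS : MeasurableSet {p : K × K | J (r p.2) = p.2} :=
      measurableSet_eq_fun (mJ.comp (mr.comp measurable_snd)) measurable_snd
    refine (trae _ hS).2 (Filter.Eventually.of_forall fun x => ?_)
    change J (r (J x)) = J x
    rw [hr']
  have fR : ∀ᵐ x ∂μ, J (r (f x)) = f x := by
    have hS : MeasurableSet {p : K × K | J (r p.1) = p.1} :=
      measurableSet_eq_fun (mJ.comp (mr.comp measurable_fst)) measurable_fst
    refine (trae _ hS).1 (Filter.Eventually.of_forall fun x => ?_)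
    change J (r (J x)) = J x
    rw [hr']
  let Φ : X → X := fun x => r (g x)
  let Γ : X → X := fun x => r (f x)
  have mΦ : Measurable Φ := mr.comp mg
  have mΓ : Measurable Γ := mr.comp mf
  have pΦ : MeasurePreserving Φ μ μ := by
    refine ⟨mΦ, ?_⟩
    ext B hB
    rw [Measure.map_apply mΦ hB]
    have := tr {p | r p.2 ∈ B} ((mr.comp measurable_snd) hB)
    refine Eq.trans this ?_
    congr 1
    ext x
    change r (J x) ∈ B ↔ x ∈ B
    rw [hr']
  have pΓ : MeasurePreserving Γ μ μ := by
    refine ⟨mΓ, ?_⟩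
    ext B hB
    rw [Measure.map_apply mΓ hB]
    have := tr {p | r p.1 ∈ B} ((mr.comp measurable_fst) hB)
    refine Eq.trans this.symm ?_
    congr 1
    ext x
    change r (J x) ∈ B ↔ x ∈ B
    rw [hr']
  have h1 : ∀ᵐ x ∂μ, Γ (Φ x) = x := by
    have hS : MeasurableSet {p : K × K | Γ (r p.2) = r p.1} :=
      measurableSet_eq_fun (mΓ.comp (mr.comp measurable_snd)) (mr.comp measurable_fst)
    have := (trae _ hS).2 (Filter.Eventually.of_forall fun x => by
      change Γ (r (J x)) = r (f x)
      rw [hr'])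
    filter_upwards [this] with x hx
    have hx' : Γ (r (g x)) = r (J x) := hx
    rwa [hr'] at hx'
  have h2 : ∀ᵐ x ∂μ, Φ (Γ x) = x := by
    have hS : MeasurableSet {p : K × K | Φ (r p.1) = r p.2} :=
      measurableSet_eq_fun (mΦ.comp (mr.comp measurable_fst)) (mr.comp measurable_snd)
    have := (trae _ hS).1 (Filter.Eventually.of_forall fun x => by
      change Φ (r (J x)) = r (g x)
      rw [hr'])
    filter_upwards [this] with x hx
    have hx' : Φ (r (f x)) = r (J x) := hx
    rwa [hr'] at hx'
  obtain ⟨ψ, q1, q2⟩ := aux_fix μ hna Φ Γ pΦ pΓ h1 h2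
  refine ⟨ψ, fun A => ⟨?_, ?_⟩⟩
  · filter_upwards [q2, fR] with x hx hf
    change (ψ.1.symm x ∈ (A : Set X)) = (x ∈ E A)
    rw [hx]
    exact congrFun hf A
  · filter_upwards [q1, gR] with x hx hf
    change (ψ.1 x ∈ (A : Set X)) = (x ∈ F A)
    rw [hx]
    exact congrFun hf A

end part8


section part9

lemma aux_alg {X : Type*} [MeasurableSpace X] [StandardBorelSpace X]
    (μ : Measure X) [IsProbabilityMeasure μ] :
    ∃ 𝒜 : Set (Set X), 𝒜.Countable ∧ (∀ A ∈ 𝒜, MeasurableSet A) ∧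
      (∀ x y, (∀ A ∈ 𝒜, x ∈ A ↔ y ∈ A) → x = y) ∧
      ∀ B, MeasurableSet B → ∀ ε : ℝ, 0 < ε → ∃ A ∈ 𝒜, μ.real (symmDiff B A) < ε := by
  let 𝒜 : Set (Set X) := generateSetAlgebra (MeasurableSpace.countableGeneratingSet X)
  have hgen : (inferInstance : MeasurableSpace X) = MeasurableSpace.generateFrom 𝒜 := by
    rw [generateFrom_generateSetAlgebra_eq, MeasurableSpace.generateFrom_countableGeneratingSet]
  have hd := Measure.MeasureDense.of_generateFrom_isSetAlgebra_finite μ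
    (isSetAlgebra_generateSetAlgebra (𝒜 := MeasurableSpace.countableGeneratingSet X)) hgen
  refine ⟨𝒜, countable_generateSetAlgebra MeasurableSpace.countable_countableGeneratingSet,
    hd.measurable, ?_, ?_⟩
  · have hs : @MeasurableSpace.SeparatesPoints X (MeasurableSpace.generateFrom 𝒜) := by
      rw [← hgen]; infer_instance
    exact MeasurableSpace.separating_of_generateFrom 𝒜
  · intro B hB ε hε
    obtain ⟨A, hA, h⟩ := hd.approx B hB (measure_ne_top _ _) ε hε
    refine ⟨A, hA, ?_⟩
    rw [measureReal_def]
    exact (ENNReal.lt_ofReal_iff_toReal_lt (measure_ne_top _ _)).1 h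

lemma aux_mp_symmDiff {X : Type*} [MeasurableSpace X] (μ : Measure X) (e : X → X)
    (he : MeasurePreserving e μ μ) (A B : Set X) (hA : MeasurableSet A) (hB : MeasurableSet B) :
    μ.real (symmDiff (e ⁻¹' A) (e ⁻¹' B)) = μ.real (symmDiff A B) := by
  rw [measureReal_def, measureReal_def, ← he.measure_preimage (hA.symmDiff hB).nullMeasurableSet]
  rfl

lemma aux_mp_symm {X : Type*} [MeasurableSpace X] {μ : Measure X} (φ : MPE μ) :
    MeasurePreserving φ.1.symm μ μ := φ.2.symm φ.1

lemma aux_cont {X : Type*} [MeasurableSpace X] (μ : Measure X) [IsProbabilityMeasure μ]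
    {A : Set X} (hA : MeasurableSet A) :
    Continuous (fun φ : MPE μ => auxI μ (hA.preimage φ.1.symm.measurable)) := by
  have h : Continuous (fun φ : MPE μ => fun A : {A : Set X // MeasurableSet A} =>
      (indicatorConstLp 1 (A.2.preimage φ.1.symm.measurable) (measure_ne_top μ _)
        (1 : ℝ) : Lp ℝ 1 μ)) := continuous_induced_dom
  exact (continuous_apply (⟨A, hA⟩ : {A : Set X // MeasurableSet A})).comp h

lemma aux_baire {X : Type*} [MeasurableSpace X] [StandardBorelSpace X]
    (μ : Measure X) [IsProbabilityMeasure μ] (hna : ∀ x, μ {x} = 0) : BaireSpace (MPE μ) := by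
  classical
  obtain ⟨𝒜, h𝒜c, h𝒜m, h𝒜s, h𝒜d⟩ := aux_alg μ
  have : Countable 𝒜 := h𝒜c.to_subtype
  let e : MPE μ → (𝒜 → Lp ℝ 1 μ) × (𝒜 → Lp ℝ 1 μ) := fun φ =>
    (fun A => auxI μ ((h𝒜m A A.2).preimage φ.1.symm.measurable),
     fun A => auxI μ ((h𝒜m A A.2).preimage φ.1.measurable))
  have hind : (MPE.topologicalSpace : TopologicalSpace (MPE μ)) =
      TopologicalSpace.induced e inferInstance := by
    refine le_antisymm ?_ ?_
    · rw [← continuous_iff_le_induced]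
      refine Continuous.prodMk (continuous_pi fun A => aux_cont μ (h𝒜m A A.2)) (continuous_pi fun A => ?_)
      rw [continuous_iff_continuousAt]
      intro φ0
      have hA := h𝒜m A A.2
      have hB : MeasurableSet (φ0.1 ⁻¹' (A : Set X)) := φ0.1.measurable hA
      have h := (aux_cont μ hB).tendsto φ0
      rw [tendsto_iff_dist_tendsto_zero] at h
      rw [ContinuousAt, tendsto_iff_dist_tendsto_zero]
      refine h.congr fun φ => ?_
      rw [auxI_dist, auxI_dist]
      rw [← aux_mp_symmDiff μ φ.1.symm (aux_mp_symm φ) _ _ (φ.1.measurable hA) hB, symmDiff_comm]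
      congr 2
      · ext x; simp
    · change _ ≤ TopologicalSpace.induced _ _
      rw [← continuous_iff_le_induced]
      let t := TopologicalSpace.induced e inferInstance
      refine @continuous_pi _ _ _ t _ _ fun B => ?_
      have hB : MeasurableSet B.1 := B.2
      rw [@continuous_iff_continuousAt _ _ t _]
      intro φ0
      change Tendsto _ _ _
      rw [Metric.tendsto_nhds]
      intro ε hε
      obtain ⟨A, hA, hAB⟩ := h𝒜d B.1 hB (ε / 3) (by positivity)
      have hAm := h𝒜m A hA
      have hce : @Continuous _ _ t _ e := continuous_induced_dom
      have hc1 : @Continuous _ _ t _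
          (fun φ : MPE μ => auxI μ (hAm.preimage φ.1.symm.measurable)) :=
        ((continuous_apply (⟨A, hA⟩ : 𝒜)).comp continuous_fst).comp hce
      have := (@Continuous.tendsto _ _ t _ _ hc1 φ0)
      rw [Metric.tendsto_nhds] at this
      filter_upwards [this (ε / 3) (by positivity)] with φ hφ
      have d1 : dist (auxI μ (hB.preimage φ.1.symm.measurable))
          (auxI μ (hAm.preimage φ.1.symm.measurable)) < ε / 3 := by
        rw [auxI_dist, aux_mp_symmDiff μ _ (aux_mp_symm φ) _ _ hB hAm]; exact hAB
      have d2 : dist (auxI μ (hAm.preimage φ0.1.symm.measurable))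
          (auxI μ (hB.preimage φ0.1.symm.measurable)) < ε / 3 := by
        rw [auxI_dist, aux_mp_symmDiff μ _ (aux_mp_symm φ0) _ _ hAm hB, symmDiff_comm]; exact hAB
      have d3 := dist_triangle4 (auxI μ (hB.preimage φ.1.symm.measurable))
        (auxI μ (hAm.preimage φ.1.symm.measurable)) (auxI μ (hAm.preimage φ0.1.symm.measurable))
        (auxI μ (hB.preimage φ0.1.symm.measurable))
      calc _ ≤ _ := d3
        _ < ε / 3 + ε / 3 + ε / 3 := by gcongr
        _ = ε := by ring
  have hcl : IsClosed (Set.range e) := by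
    refine IsSeqClosed.isClosed ?_
    intro s p hs hp
    choose φ hφ using hs
    obtain rfl : (fun r => e (φ r)) = s := funext hφ
    have l1 : ∀ A : 𝒜, Tendsto (fun r => (e (φ r)).1 A) atTop (nhds (p.1 A)) := fun A =>
      ((continuous_apply A).comp continuous_fst).tendsto p |>.comp hp
    have l2 : ∀ A : 𝒜, Tendsto (fun r => (e (φ r)).2 A) atTop (nhds (p.2 A)) := fun A =>
      ((continuous_apply A).comp continuous_snd).tendsto p |>.comp hp
    choose E hE hEp lE using fun A : 𝒜 => auxI_lim μ _ (fun r => (h𝒜m A A.2).preimage (φ r).1.symm.measurable) _ (l1 A)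
    choose F hF hFp lF using fun A : 𝒜 => auxI_lim μ _ (fun r => (h𝒜m A A.2).preimage (φ r).1.measurable) _ (l2 A)
    obtain ⟨ψ, hψ⟩ := aux_complete μ hna 𝒜 h𝒜c h𝒜m h𝒜s φ E F hE hF lE lF
    refine ⟨ψ, Prod.ext (funext fun A => ?_) (funext fun A => ?_)⟩
    · rw [hEp, ← dist_eq_zero, auxI_dist, measureReal_def,
        measure_symmDiff_eq_zero_iff.2 (hψ A).1]; rfl
    · rw [hFp, ← dist_eq_zero, auxI_dist, measureReal_def,
        measure_symmDiff_eq_zero_iff.2 (hψ A).2]; rfl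
  rw [hind]
  let u : UniformSpace (MPE μ) := UniformSpace.comap e inferInstance
  have hu : IsUniformInducing e := ⟨rfl⟩
  have hcomp : CompleteSpace (MPE μ) :=
    (completeSpace_iff_isComplete_range hu).2 hcl.isComplete
  have hcg : (uniformity (MPE μ)).IsCountablyGenerated := by
    change (Filter.comap _ _).IsCountablyGenerated
    infer_instance
  exact @BaireSpace.of_completelyPseudoMetrizable (MPE μ) u.toTopologicalSpace
    (@TopologicalSpace.IsCompletelyPseudoMetrizableSpace.of_completeSpace_pseudometrizable
      (MPE μ) u hcomp hcg)

end part9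

section part10

lemma aux_noatom {X : Type*} [MeasurableSpace X] [StandardBorelSpace X]
    (μ : Measure X) [IsProbabilityMeasure μ]
    (T : X ≃ᵐ X)
    (hmix : ∀ A B : Set X, MeasurableSet A → MeasurableSet B →
      Tendsto (fun n : ℕ => μ.real (A ∩ ((⇑T)^[n]) ⁻¹' B)) atTop
        (nhds (μ.real A * μ.real B)))
    (𝒞 : Set (Set X)) (h𝒞 : ∀ C ∈ 𝒞, MeasurableSet C) (hent : 0 < famEntropy μ 𝒞) :
    ∀ x, μ {x} = 0 := by
  intro x
  by_contra hx
  have hpos : 0 < μ.real {x} := ENNReal.toReal_pos hx (measure_ne_top μ _)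
  have h1 := hmix {x} {x} (measurableSet_singleton x) (measurableSet_singleton x)
  have h2 : ∀ n : ℕ, μ.real ({x} ∩ ((⇑T)^[n]) ⁻¹' {x}) ∈ ({0, μ.real {x}} : Set ℝ) := by
    intro n
    by_cases h : (⇑T)^[n] x = x
    · right
      have : ({x} ∩ ((⇑T)^[n]) ⁻¹' {x} : Set X) = {x} := by
        ext z; simp only [Set.mem_inter_iff, Set.mem_singleton_iff, Set.mem_preimage]
        exact ⟨fun h => h.1, fun hz => ⟨hz, by rw [hz, h]⟩⟩
      rw [this]; rfl
    · left
      have : ({x} ∩ ((⇑T)^[n]) ⁻¹' {x} : Set X) = ∅ := by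
        ext z; simp only [Set.mem_inter_iff, Set.mem_singleton_iff, Set.mem_preimage,
          Set.mem_empty_iff_false, iff_false]
        rintro ⟨rfl, h'⟩; exact h h'
      rw [this]; simp
  have h3 : μ.real {x} * μ.real {x} ∈ ({0, μ.real {x}} : Set ℝ) :=
    (Set.Finite.isClosed (by simp)).mem_of_tendsto h1 (Eventually.of_forall h2)
  have h4 : μ.real {x} = 1 := by
    rcases h3 with h | h
    · nlinarith
    · have h : μ.real {x} * μ.real {x} = μ.real {x} := h
      nlinarith
  obtain ⟨y, hy, h⟩ := aux_entropy μ 𝒞 h𝒞 hent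
  obtain ⟨C, hC, hCy⟩ := h Unit (fun _ => ()) (fun J => measurable_const (MeasurableSpace.measurableSet_top (s := J)))
  have hcompl : μ.real ({x}ᶜ) = 0 := by
    rw [probReal_compl_eq_one_sub (measurableSet_singleton x), h4]; ring
  by_cases hxC : x ∈ C
  · have := hCy Set.univ
    have h5 : μ.real (symmDiff C ((fun _ => ()) ⁻¹' Set.univ)) ≤ μ.real ({x}ᶜ) := by
      refine measureReal_mono ?_
      rintro z hz rfl
      simp [Set.mem_symmDiff, hxC] at hz
    linarith
  · have := hCy ∅
    have h5 : μ.real (symmDiff C ((fun _ => ()) ⁻¹' ∅)) ≤ μ.real ({x}ᶜ) := by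
      refine measureReal_mono ?_
      rintro z hz rfl
      simp [Set.mem_symmDiff, hxC] at hz
    linarith

lemma aux_conj_iter {X : Type*} [MeasurableSpace X] {μ : Measure X}
    (T : X ≃ᵐ X) (φ : MPE μ) (n : ℕ) (x : X) :
    (MPE.conj T φ)^[n] x = φ.1.symm ((⇑T)^[n] (φ.1 x)) := by
  induction n generalizing x with
  | zero => simp
  | succ n ih =>
    rw [Function.iterate_succ_apply, Function.iterate_succ_apply, ih]
    simp [MPE.conj]

lemma aux_conj_meas {X : Type*} [MeasurableSpace X] {μ : Measure X}
    (T : X ≃ᵐ X) (φ : MPE μ) (n : ℕ) (C D : Set X) :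
    μ.real (D ∩ (MPE.conj T φ)^[n] ⁻¹' C) =
      μ.real (φ.1.symm ⁻¹' D ∩ (⇑T)^[n] ⁻¹' (φ.1.symm ⁻¹' C)) := by
  rw [measureReal_def, measureReal_def, ← φ.2.measure_preimage_equiv (φ.1.symm ⁻¹' D ∩ _)]
  congr 2
  ext x
  simp [aux_conj_iter]

lemma aux_open {X : Type*} [MeasurableSpace X]
    (μ : Measure X) [IsProbabilityMeasure μ]
    (T : X ≃ᵐ X) (hT : MeasurePreserving (⇑T) μ μ) {C : Set X} (hC : MeasurableSet C) (n : ℕ) :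
    Continuous (fun φ : MPE μ => μ.real (C ∩ (MPE.conj T φ)^[n] ⁻¹' C)) := by
  rw [continuous_iff_continuousAt]
  intro φ0
  have h := (aux_cont μ hC).tendsto φ0
  rw [tendsto_iff_dist_tendsto_zero] at h
  rw [ContinuousAt, tendsto_iff_dist_tendsto_zero]
  refine squeeze_zero (fun _ => dist_nonneg) (g := fun φ => 2 * dist (auxI μ (hC.preimage φ.1.symm.measurable)) (auxI μ (hC.preimage φ0.1.symm.measurable))) ?_ (by simpa using h.const_mul 2)
  intro φ
  rw [Real.dist_eq, aux_conj_meas, aux_conj_meas, auxI_dist]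
  set A := φ.1.symm ⁻¹' C with hAdef
  set B := φ0.1.symm ⁻¹' C with hBdef
  have hA : MeasurableSet A := hC.preimage φ.1.symm.measurable
  have hB : MeasurableSet B := hC.preimage φ0.1.symm.measurable
  have hTn := hT.iterate n
  have e1 : μ.real ((⇑T)^[n] ⁻¹' (symmDiff A B)) = μ.real (symmDiff A B) :=
    hTn.measureReal_preimage (hA.symmDiff hB).nullMeasurableSet
  refine (abs_measureReal_sub_le_measureReal_symmDiff
    (hA.inter (hTn.measurable hA)).nullMeasurableSet
    (hB.inter (hTn.measurable hB)).nullMeasurableSet).trans ?_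
  have hsub : symmDiff (A ∩ (⇑T)^[n] ⁻¹' A) (B ∩ (⇑T)^[n] ⁻¹' B) ⊆
      symmDiff A B ∪ (⇑T)^[n] ⁻¹' (symmDiff A B) := by
    intro x
    simp only [Set.mem_symmDiff, Set.mem_inter_iff, Set.mem_union, Set.mem_preimage]
    tauto
  calc _ ≤ μ.real (symmDiff A B ∪ (⇑T)^[n] ⁻¹' (symmDiff A B)) := measureReal_mono hsub
    _ ≤ _ := measureReal_union_le _ _
    _ = _ := by rw [e1]; ring

lemma aux_dense {X : Type*} [MeasurableSpace X] [StandardBorelSpace X]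
    (μ : Measure X) [IsProbabilityMeasure μ] (hna : ∀ x, μ {x} = 0)
    (T : X ≃ᵐ X) (hT : MeasurePreserving (⇑T) μ μ)
    (hmix : ∀ A B : Set X, MeasurableSet A → MeasurableSet B →
      Tendsto (fun n : ℕ => μ.real (A ∩ ((⇑T)^[n]) ⁻¹' B)) atTop
        (nhds (μ.real A * μ.real B)))
    (𝒞 : Set (Set X)) (h𝒞 : ∀ C ∈ 𝒞, MeasurableSet C) (y : ℝ) (hy : 0 < y)
    (H : ∀ (κ : Type) [Fintype κ] (l : X → κ), (∀ J : Set κ, MeasurableSet (l ⁻¹' J)) →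
      ∃ C ∈ 𝒞, ∀ J : Set κ, y ≤ μ.real (symmDiff C (l ⁻¹' J))) (N : ℕ) :
    Dense {φ : MPE μ | ∃ n ≥ N, ∃ C ∈ 𝒞,
      y ^ 2 / 32 < |μ.real (C ∩ (MPE.conj T φ)^[n] ⁻¹' C) - μ.real C ^ 2|} := by
  classical
  rw [dense_iff_inter_open]
  rintro U hU ⟨φ0, hφ0⟩
  obtain ⟨V, hV, rfl⟩ := isOpen_induced_iff.1 hU
  obtain ⟨I, u, hu, hIV⟩ := isOpen_pi_iff.1 hV _ hφ0
  let l : X → (Fin I.card → Bool) := fun x i => decide (x ∈ (I.equivFin.symm i).1.1)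
  have hlm : Measurable l := measurable_pi_lambda _ fun i =>
    measurable_to_bool (by
      convert (I.equivFin.symm i).1.2 using 1
      ext x
      simp [l])
  have hl : ∀ J : Set (Fin I.card → Bool), MeasurableSet (l ⁻¹' J) := fun J =>
    hlm (Set.toFinite J).measurableSet
  obtain ⟨C, hC, hCy⟩ := H _ l hl
  let T' : X ≃ᵐ X := φ0.1.trans (T.trans φ0.1.symm)
  have hT'c : (⇑T' : X → X) = MPE.conj T φ0 := rfl
  have hT' : MeasurePreserving (⇑T') μ μ := (aux_mp_symm φ0).comp (hT.comp φ0.2)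
  have hmp : ∀ A : Set X, MeasurableSet A → μ.real (φ0.1.symm ⁻¹' A) = μ.real A := fun A hA =>
    (aux_mp_symm φ0).measureReal_preimage hA.nullMeasurableSet
  have hmix' : ∀ A B : Set X, MeasurableSet A → MeasurableSet B →
      Tendsto (fun n : ℕ => μ.real (A ∩ ((⇑T')^[n]) ⁻¹' B)) atTop
        (nhds (μ.real A * μ.real B)) := by
    intro A B hA hB
    rw [hT'c]
    simp_rw [aux_conj_meas]
    rw [← hmp A hA, ← hmp B hB]
    exact hmix _ _ (hA.preimage φ0.1.symm.measurable) (hB.preimage φ0.1.symm.measurable)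
  obtain ⟨n, hn, τ, hτ, hττ, hτl, hfin⟩ :=
    aux_step μ hna T' hT' hmix' l hl C (h𝒞 C hC) y hy hCy N
  let φ : MPE μ := ⟨τ.trans φ0.1, φ0.2.comp hτ⟩
  have hτs : ∀ x, τ.symm x = τ x := fun x => by
    rw [MeasurableEquiv.symm_apply_eq, hττ]
  refine ⟨φ, hIV ?_, n, hn, C, hC, ?_⟩
  · intro A hA
    have key : φ.1.symm ⁻¹' A.1 = φ0.1.symm ⁻¹' A.1 := by
      ext x
      have h1 : φ.1.symm x = τ (φ0.1.symm x) := hτs _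
      rw [Set.mem_preimage, Set.mem_preimage, h1]
      have h2 := congrFun (hτl (φ0.1.symm x)) (I.equivFin ⟨A, hA⟩)
      simpa [l] using h2
    have h3 := (hu A hA).2
    have h4 : auxI μ (A.2.preimage φ.1.symm.measurable) =
        auxI μ (A.2.preimage φ0.1.symm.measurable) := by
      rw [← dist_eq_zero, auxI_dist, key]; simp
    change auxI μ (A.2.preimage φ.1.symm.measurable) ∈ u A
    rw [h4]
    exact h3
  · rw [aux_conj_meas]
    have e1 : φ.1.symm ⁻¹' C = φ0.1.symm ⁻¹' (τ ⁻¹' C) := by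
      ext x
      have h1 : φ.1.symm x = τ (φ0.1.symm x) := hτs _
      rw [Set.mem_preimage, h1]; rfl
    rw [e1, ← aux_conj_meas, ← hT'c]
    exact hfin

end part10

/-- If `T` is an invertible strong mixing transformation of a Lebesgue probability space
(formalized as a standard Borel space with a probability measure) and `H_μ(𝒞) > 0`, then there
is a dense `G_δ` set `G ⊆ Φ` such that uniform strong mixing over `𝒞` fails for `T_φ` for
every `φ ∈ G`. -/
theorem dense_Gdelta_uniform_strong_mixing_fails_of_pos_entropy
    {X : Type*} [MeasurableSpace X] [StandardBorelSpace X]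
    (μ : Measure X) [IsProbabilityMeasure μ]
    (T : X ≃ᵐ X) (hT : MeasurePreserving (⇑T) μ μ)
    (hmix : ∀ A B : Set X, MeasurableSet A → MeasurableSet B →
      Tendsto (fun n : ℕ => (μ (A ∩ ((⇑T)^[n]) ⁻¹' B)).toReal) atTop
        (nhds ((μ A).toReal * (μ B).toReal)))
    (𝒞 : Set (Set X)) (h𝒞 : ∀ C ∈ 𝒞, MeasurableSet C) (hent : 0 < famEntropy μ 𝒞) :
    ∃ G : Set (MPE μ), IsGδ G ∧ Dense G ∧ ∀ φ ∈ G,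
      0 < Filter.atTop.limsup (fun n : ℕ => ⨆ C : 𝒞,
        |(μ ((C : Set X) ∩ ((MPE.conj T φ)^[n]) ⁻¹' (C : Set X))).toReal -
          (μ (C : Set X)).toReal ^ 2|) := by
  classical
  have hmix' : ∀ A B : Set X, MeasurableSet A → MeasurableSet B →
      Tendsto (fun n : ℕ => μ.real (A ∩ ((⇑T)^[n]) ⁻¹' B)) atTop
        (nhds (μ.real A * μ.real B)) := hmix
  have hna := aux_noatom μ T hmix' 𝒞 h𝒞 hent
  have hbaire := aux_baire μ hna
  obtain ⟨y, hy, H⟩ := aux_entropy μ 𝒞 h𝒞 hent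
  let O : ℕ → Set (MPE μ) := fun N => {φ : MPE μ | ∃ n ≥ N, ∃ C ∈ 𝒞,
      y ^ 2 / 32 < |μ.real (C ∩ (MPE.conj T φ)^[n] ⁻¹' C) - μ.real C ^ 2|}
  have hO : ∀ N, IsOpen (O N) := by
    intro N
    have : O N = ⋃ n : ℕ, ⋃ _ : n ≥ N, ⋃ C : Set X, ⋃ _ : C ∈ 𝒞,
        {φ : MPE μ | y ^ 2 / 32 < |μ.real (C ∩ (MPE.conj T φ)^[n] ⁻¹' C) - μ.real C ^ 2|} := by
      ext φ
      simp [O]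
    rw [this]
    refine isOpen_iUnion fun n => isOpen_iUnion fun _ => isOpen_iUnion fun C =>
      isOpen_iUnion fun hC => ?_
    exact isOpen_lt continuous_const ((aux_open μ T hT (h𝒞 C hC) n).sub continuous_const).abs
  refine ⟨⋂ N, O N, IsGδ.iInter_of_isOpen hO,
    dense_iInter_of_isOpen hO fun N => aux_dense μ hna T hT hmix' 𝒞 h𝒞 y hy H N, ?_⟩
  intro φ hφ
  rw [Set.mem_iInter] at hφ
  have hb : ∀ (n : ℕ) (C : 𝒞), |(μ ((C : Set X) ∩ ((MPE.conj T φ)^[n]) ⁻¹' (C : Set X))).toReal -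
          (μ (C : Set X)).toReal ^ 2| ≤ 1 := by
    intro n C
    have a1 : μ.real ((C : Set X) ∩ ((MPE.conj T φ)^[n]) ⁻¹' (C : Set X)) ≤ 1 :=
      measureReal_le_one
    have a2 : 0 ≤ μ.real ((C : Set X) ∩ ((MPE.conj T φ)^[n]) ⁻¹' (C : Set X)) :=
      measureReal_nonneg
    have a3 : μ.real (C : Set X) ≤ 1 := measureReal_le_one
    have a4 : 0 ≤ μ.real (C : Set X) := measureReal_nonneg
    change |μ.real ((C : Set X) ∩ ((MPE.conj T φ)^[n]) ⁻¹' (C : Set X)) -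
      μ.real (C : Set X) ^ 2| ≤ 1
    rw [abs_le]
    constructor <;> nlinarith
  have hδ : (0 : ℝ) < y ^ 2 / 32 := by positivity
  refine lt_of_lt_of_le hδ (le_limsup_of_frequently_le ?_ ?_)
  · rw [frequently_atTop]
    intro N
    obtain ⟨n, hn, C, hC, h⟩ := hφ N
    refine ⟨n, hn, h.le.trans ?_⟩
    exact le_ciSup (f := fun C : 𝒞 =>
      |(μ ((C : Set X) ∩ ((MPE.conj T φ)^[n]) ⁻¹' (C : Set X))).toReal -
          (μ (C : Set X)).toReal ^ 2|)
      ⟨1, by rintro _ ⟨C, rfl⟩; exact hb n C⟩ (⟨C, hC⟩ : 𝒞)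
  · refine isBoundedUnder_of ⟨1, fun n => ?_⟩
    exact Real.iSup_le (hb n) zero_le_one
end

section
/- Let T be a weak mixing measure-preserving transformation of a probability space (X, S, μ) and let C ⊆ S be a family of measurable sets with H_μ(C) = 0. Then T is uniformly weak mixing on C: lim_{n→∞} sup_{A,B ∈ C} (1/n) Σ_{i=0}^{n-1} |μ(A ∩ T^{-i} B) − μ(A) μ(B)| = 0. -/
open MeasureTheory Filter

theorem aux_eta_lower {a b : ℝ} (ha : 0 ≤ a) (hb : 0 ≤ b) :
    min a b + -((a + b) * Real.logb 2 (a + b)) ≤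
      -(a * Real.logb 2 a) + -(b * Real.logb 2 b) := by
  wlog h : b ≤ a generalizing a b
  · have := this hb ha (le_of_not_ge h)
    rw [min_comm, add_comm b a] at this
    linarith
  rcases hb.eq_or_lt with rfl | hb
  · simp [ha]
  have ha' : 0 < a := lt_of_lt_of_le hb h
  rw [min_eq_right h]
  have h1 : Real.logb 2 a ≤ Real.logb 2 (a + b) :=
    Real.logb_le_logb_of_le (by norm_num) ha' (by linarith)
  have h2 : Real.logb 2 (2 * b) ≤ Real.logb 2 (a + b) :=
    Real.logb_le_logb_of_le (by norm_num) (by linarith) (by linarith)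
  rw [Real.logb_mul (by norm_num) hb.ne', Real.logb_self_eq_one (by norm_num)] at h2
  nlinarith [mul_le_mul_of_nonneg_left h1 ha, mul_le_mul_of_nonneg_left h2 hb.le]

theorem aux_log_mul {a b : ℝ} (ha : 0 ≤ a) (hb : 0 ≤ b) :
    a * Real.log (a + b) - a * Real.log a ≤ b := by
  rcases ha.eq_or_lt with rfl | ha
  · simpa using hb
  have := Real.log_le_sub_one_of_pos (x := (a + b) / a) (by positivity)
  rw [Real.log_div (by positivity) ha.ne'] at this
  have h2 := mul_le_mul_of_nonneg_left this ha.le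
  have h3 : a * ((a + b) / a - 1) = b := by field_simp; ring
  nlinarith

theorem aux_eta_upper {a b : ℝ} (ha : 0 ≤ a) (hb : 0 ≤ b) :
    -(a * Real.logb 2 a) + -(b * Real.logb 2 b) ≤
      (a + b) / Real.log 2 + -((a + b) * Real.logb 2 (a + b)) := by
  have h1 := aux_log_mul ha hb
  have h2 := aux_log_mul hb ha
  rw [add_comm b a] at h2
  have hl : 0 < Real.log 2 := Real.log_pos (by norm_num)
  have : 0 ≤ (a + b - (a * Real.log (a + b) - a * Real.log a)
      - (b * Real.log (a + b) - b * Real.log b)) / Real.log 2 := by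
    apply div_nonneg _ hl.le
    linarith
  simp only [Real.logb]
  have e : (a + b) / Real.log 2 + -((a + b) * (Real.log (a + b) / Real.log 2))
    - (-(a * (Real.log a / Real.log 2)) + -(b * (Real.log b / Real.log 2))) =
    (a + b - (a * Real.log (a + b) - a * Real.log a)
      - (b * Real.log (a + b) - b * Real.log b)) / Real.log 2 := by
    field_simp
    ring
  linarith

/-- The cell of the join with sign pattern `s`. -/
def auxCell {X : Type*} {n : ℕ} (C : Fin n → Set X) (s : Fin n → Bool) : Set X :=
  ⋂ i, if s i then C i else (C i)ᶜ

theorem auxCell_meas {X : Type*} [MeasurableSpace X] {n : ℕ} {C : Fin n → Set X}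
    (hC : ∀ i, MeasurableSet (C i)) (s : Fin n → Bool) : MeasurableSet (auxCell C s) := by
  refine MeasurableSet.iInter fun i => ?_
  split_ifs
  · exact hC i
  · exact (hC i).compl

theorem mem_auxCell {X : Type*} {n : ℕ} (C : Fin n → Set X) (s : Fin n → Bool) (x : X) :
    x ∈ auxCell C s ↔ ∀ i, (s i = true ↔ x ∈ C i) := by
  simp only [auxCell, Set.mem_iInter]
  refine forall_congr' fun i => ?_
  cases s i <;> simp

theorem exists_auxCell {X : Type*} {n : ℕ} (C : Fin n → Set X) (x : X) :
    ∃ s, x ∈ auxCell C s := by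
  classical
  exact ⟨fun i => decide (x ∈ C i), by simp [mem_auxCell]⟩

theorem auxCell_unique {X : Type*} {n : ℕ} {C : Fin n → Set X} {x : X} {s t : Fin n → Bool}
    (hs : x ∈ auxCell C s) (ht : x ∈ auxCell C t) : s = t := by
  rw [mem_auxCell] at hs ht
  funext i
  have := (hs i).trans (ht i).symm
  exact Bool.eq_iff_iff.2 this

theorem auxCell_snoc_true {X : Type*} {n : ℕ} (D : Fin n → Set X) (C : Set X)
    (s : Fin n → Bool) :
    auxCell (Fin.snoc D C : Fin (n + 1) → Set X) (Fin.snoc s true : Fin (n + 1) → Bool)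
      = auxCell D s ∩ C := by
  ext x
  simp [mem_auxCell, Fin.forall_fin_succ']

theorem auxCell_snoc_false {X : Type*} {n : ℕ} (D : Fin n → Set X) (C : Set X)
    (s : Fin n → Bool) :
    auxCell (Fin.snoc D C : Fin (n + 1) → Set X) (Fin.snoc s false : Fin (n + 1) → Bool)
      = auxCell D s \ C := by
  ext x
  simp [mem_auxCell, Fin.forall_fin_succ']

theorem joinEntropy_eq {X : Type*} [MeasurableSpace X] (μ : Measure X) {n : ℕ}
    (C : Fin n → Set X) :
    joinEntropy μ C = ∑ s : Fin n → Bool,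
      -(μ.real (auxCell C s) * Real.logb 2 (μ.real (auxCell C s))) := rfl

theorem aux_sum_snoc {n : ℕ} (F : (Fin (n + 1) → Bool) → ℝ) :
    ∑ s, F s = ∑ s : Fin n → Bool, (F (Fin.snoc s true : Fin (n + 1) → Bool)
      + F (Fin.snoc s false : Fin (n + 1) → Bool)) := by
  rw [← (Fin.snocEquiv (fun _ : Fin (n + 1) => Bool)).sum_comp, Fintype.sum_prod_type_right]
  refine Finset.sum_congr rfl fun s _ => ?_
  rw [Fintype.sum_bool]
  rfl

theorem joinEntropy_snoc {X : Type*} [MeasurableSpace X] (μ : Measure X) {n : ℕ}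
    (D : Fin n → Set X) (C : Set X) :
    joinEntropy μ (Fin.snoc D C : Fin (n + 1) → Set X) = ∑ s : Fin n → Bool,
      (-(μ.real (auxCell D s ∩ C) * Real.logb 2 (μ.real (auxCell D s ∩ C))) +
       -(μ.real (auxCell D s \ C) * Real.logb 2 (μ.real (auxCell D s \ C)))) := by
  rw [joinEntropy_eq, aux_sum_snoc]
  simp only [auxCell_snoc_true, auxCell_snoc_false]

theorem joinEntropy_lower {X : Type*} [MeasurableSpace X] (μ : Measure X)
    [IsProbabilityMeasure μ] {n : ℕ} (D : Fin n → Set X) (C : Set X) (hC : MeasurableSet C) :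
    ∑ s : Fin n → Bool, min (μ.real (auxCell D s ∩ C)) (μ.real (auxCell D s \ C))
      + joinEntropy μ D ≤ joinEntropy μ (Fin.snoc D C : Fin (n + 1) → Set X) := by
  rw [joinEntropy_snoc, joinEntropy_eq, ← Finset.sum_add_distrib]
  refine Finset.sum_le_sum fun s _ => ?_
  have := aux_eta_lower (a := μ.real (auxCell D s ∩ C)) (b := μ.real (auxCell D s \ C))
    measureReal_nonneg measureReal_nonneg
  rwa [measureReal_inter_add_sdiff hC] at this

theorem aux_sum_cell {X : Type*} [MeasurableSpace X] (μ : Measure X)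
    [IsProbabilityMeasure μ] {n : ℕ} (D : Fin n → Set X) (hD : ∀ i, MeasurableSet (D i)) :
    ∑ s : Fin n → Bool, μ.real (auxCell D s) ≤ 1 := by
  rw [← measureReal_biUnion_finset (s := Finset.univ) (f := auxCell D)]
  · exact measureReal_le_one
  · intro s _ t _ hst
    refine Set.disjoint_left.2 fun x hx hx' => hst (auxCell_unique hx hx')
  · intro s _
    exact auxCell_meas hD s

theorem joinEntropy_upper {X : Type*} [MeasurableSpace X] (μ : Measure X)
    [IsProbabilityMeasure μ] {n : ℕ} (D : Fin n → Set X) (hD : ∀ i, MeasurableSet (D i))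
    (C : Set X) (hC : MeasurableSet C) :
    joinEntropy μ (Fin.snoc D C : Fin (n + 1) → Set X) ≤ 1 / Real.log 2 + joinEntropy μ D := by
  have hl : 0 < Real.log 2 := Real.log_pos (by norm_num)
  have : joinEntropy μ (Fin.snoc D C : Fin (n + 1) → Set X) ≤
      (∑ s : Fin n → Bool, μ.real (auxCell D s)) / Real.log 2 + joinEntropy μ D := by
    rw [joinEntropy_snoc, joinEntropy_eq, Finset.sum_div, ← Finset.sum_add_distrib]
    refine Finset.sum_le_sum fun s _ => ?_
    have := aux_eta_upper (a := μ.real (auxCell D s ∩ C)) (b := μ.real (auxCell D s \ C))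
      measureReal_nonneg measureReal_nonneg
    rwa [measureReal_inter_add_sdiff hC] at this
  have h2 := div_le_div_of_nonneg_right (aux_sum_cell μ D hD) hl.le
  linarith

theorem joinEntropy_zero {X : Type*} [MeasurableSpace X] (μ : Measure X)
    [IsProbabilityMeasure μ] (D : Fin 0 → Set X) : joinEntropy μ D = 0 := by
  simp [joinEntropy]

theorem aux_snoc_seq {X : Type*} (f : ℕ → Set X) (n : ℕ) :
    (fun i : Fin (n + 1) => f i) = (Fin.snoc (fun i : Fin n => f i) (f n) :
      Fin (n + 1) → Set X) := by
  funext i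
  refine Fin.lastCases ?_ (fun j => ?_) i
  · simp
  · simp

theorem joinEntropy_le {X : Type*} [MeasurableSpace X] (μ : Measure X)
    [IsProbabilityMeasure μ] (f : ℕ → Set X) (hf : ∀ i, MeasurableSet (f i)) (n : ℕ) :
    joinEntropy μ (fun i : Fin n => f i) ≤ n * (1 / Real.log 2) := by
  induction n with
  | zero => simp [joinEntropy_zero]
  | succ n ih =>
    rw [aux_snoc_seq]
    have := joinEntropy_upper μ (fun i : Fin n => f i) (fun i => hf i) (f n) (hf n)
    push_cast
    linarith

theorem joinEntropy_nonneg {X : Type*} [MeasurableSpace X] (μ : Measure X)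
    [IsProbabilityMeasure μ] {n : ℕ} (D : Fin n → Set X) : 0 ≤ joinEntropy μ D := by
  rw [joinEntropy_eq]
  refine Finset.sum_nonneg fun s _ => ?_
  have h1 : Real.logb 2 (μ.real (auxCell D s)) ≤ 0 :=
    Real.logb_nonpos (by norm_num) measureReal_nonneg measureReal_le_one
  have h2 : 0 ≤ μ.real (auxCell D s) := measureReal_nonneg
  nlinarith

/-- Sequence built from a rule giving the next term from the history. -/
noncomputable def auxSeq {α : Type*} (next : (n : ℕ) → (Fin n → α) → α) : ℕ → α
  | n => next n (fun i : Fin n => auxSeq next i)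
termination_by n => n
decreasing_by exact i.2

theorem aux_step_s5 {X : Type*} [MeasurableSpace X] (μ : Measure X) [IsProbabilityMeasure μ]
    (𝒞 : Set (Set X)) (h𝒞 : ∀ C ∈ 𝒞, MeasurableSet C) (hent : famEntropy μ 𝒞 = 0)
    {δ : ℝ} (hδ : 0 < δ) :
    ∃ (n : ℕ) (D : Fin n → 𝒞), ∀ C : 𝒞,
      joinEntropy μ (Fin.snoc (fun i => (D i : Set X)) (C : Set X) : Fin (n + 1) → Set X)
        < δ + joinEntropy μ (fun i => (D i : Set X)) := by
  by_contra! hcon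
  choose next hnext using hcon
  set g : ℕ → 𝒞 := auxSeq next with hg
  have hgn : ∀ n, g n = next n (fun i : Fin n => g i) := by
    intro n
    rw [hg, auxSeq]
  set f : ℕ → Set X := fun n => (g n : Set X) with hf
  have hlow : ∀ n : ℕ, n * δ ≤ joinEntropy μ (fun i : Fin n => f i) := by
    intro n
    induction n with
    | zero => simp [joinEntropy_zero]
    | succ n ih =>
      have h1 := hnext n (fun i : Fin n => g i)
      rw [← hgn n] at h1
      rw [aux_snoc_seq]
      push_cast
      have h2 : δ + joinEntropy μ (fun i : Fin n => f i) ≤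
        joinEntropy μ (Fin.snoc (fun i : Fin n => f i) (f n) : Fin (n + 1) → Set X) := h1
      linarith
  have hup : ∀ (S : {f : ℕ → Set X // ∀ i, f i ∈ 𝒞}) (n : ℕ),
      joinEntropy μ (fun i : Fin n => S.1 i) / n ≤ 1 / Real.log 2 := by
    intro S n
    have hl : 0 < Real.log 2 := Real.log_pos (by norm_num)
    rcases Nat.eq_zero_or_pos n with rfl | hn
    · simp [hl.le]
    · rw [div_le_iff₀ (by exact_mod_cast hn), mul_comm]
      exact joinEntropy_le μ S.1 (fun i => h𝒞 _ (S.2 i)) n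
  have hnn : ∀ (S : {f : ℕ → Set X // ∀ i, f i ∈ 𝒞}) (n : ℕ),
      0 ≤ joinEntropy μ (fun i : Fin n => S.1 i) / n := fun S n =>
    div_nonneg (joinEntropy_nonneg μ _) (Nat.cast_nonneg n)
  have hbdd : BddAbove (Set.range fun S : {f : ℕ → Set X // ∀ i, f i ∈ 𝒞} =>
      Filter.liminf (fun n : ℕ => joinEntropy μ (fun i : Fin n => S.1 i) / n) Filter.atTop) := by
    refine ⟨1 / Real.log 2, ?_⟩
    rintro _ ⟨S, rfl⟩
    refine liminf_le_of_le ?_ ?_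
    · exact isBoundedUnder_of ⟨0, fun n => hnn S n⟩
    · intro b hb
      obtain ⟨n, hn⟩ := hb.exists
      exact hn.trans (hup S n)
  have h1 := le_ciSup hbdd ⟨f, fun i => (g i).2⟩
  have h2 : δ ≤ Filter.liminf (fun n : ℕ => joinEntropy μ (fun i : Fin n => f i) / n)
      Filter.atTop := by
    refine le_liminf_of_le ?_ ?_
    · exact IsBoundedUnder.isCoboundedUnder_ge
        (isBoundedUnder_of ⟨1 / Real.log 2, fun n => hup ⟨f, fun i => (g i).2⟩ n⟩)
    · filter_upwards [eventually_gt_atTop 0] with n hn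
      rw [le_div_iff₀ (by exact_mod_cast hn), mul_comm]
      exact hlow n
  have h3 : δ ≤ famEntropy μ 𝒞 := h2.trans h1
  linarith

theorem aux_net {X : Type*} [MeasurableSpace X] (μ : Measure X) [IsProbabilityMeasure μ]
    (𝒞 : Set (Set X)) (h𝒞 : ∀ C ∈ 𝒞, MeasurableSet C) (hent : famEntropy μ 𝒞 = 0)
    {δ : ℝ} (hδ : 0 < δ) :
    ∃ (n : ℕ) (U : Finset (Fin n → Bool) → Set X), (∀ S, MeasurableSet (U S)) ∧
      ∀ C ∈ 𝒞, ∃ S, μ.real (symmDiff C (U S)) ≤ δ := by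
  classical
  obtain ⟨n, D, hD⟩ := aux_step_s5 μ 𝒞 h𝒞 hent hδ
  set E : Fin n → Set X := fun i => (D i : Set X) with hE
  refine ⟨n, fun S => ⋃ s ∈ S, auxCell E s, fun S => ?_, fun C hC => ?_⟩
  · exact Finset.measurableSet_biUnion _ fun s _ => auxCell_meas (fun i => h𝒞 _ (D i).2) s
  · have h1 := hD ⟨C, hC⟩
    have h2 := joinEntropy_lower μ E C (h𝒞 C hC)
    have h3 : ∑ s : Fin n → Bool, min (μ.real (auxCell E s ∩ C)) (μ.real (auxCell E s \ C)) ≤ δ := by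
      have h1' : joinEntropy μ (Fin.snoc E C : Fin (n + 1) → Set X) < δ + joinEntropy μ E := h1
      linarith
    refine ⟨Finset.univ.filter fun s => μ.real (auxCell E s \ C) ≤ μ.real (auxCell E s ∩ C), ?_⟩
    refine le_trans ?_ h3
    set S := Finset.univ.filter fun s => μ.real (auxCell E s \ C) ≤ μ.real (auxCell E s ∩ C)
      with hS
    have hsub : symmDiff C (⋃ s ∈ S, auxCell E s) ⊆ ⋃ s ∈ (Finset.univ : Finset (Fin n → Bool)),
        (if s ∈ S then auxCell E s \ C else auxCell E s ∩ C) := by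
      intro x hx
      obtain ⟨s, hs⟩ := exists_auxCell E x
      have hiff : x ∈ (⋃ s ∈ S, auxCell E s) ↔ s ∈ S := by
        simp only [Set.mem_iUnion]
        constructor
        · rintro ⟨t, ht, hxt⟩
          rwa [auxCell_unique hs hxt]
        · intro h
          exact ⟨s, h, hs⟩
      simp only [Set.mem_iUnion]
      refine ⟨s, Finset.mem_univ _, ?_⟩
      rw [Set.mem_symmDiff, hiff] at hx
      split_ifs with h
      · exact ⟨hs, by tauto⟩
      · exact ⟨hs, by tauto⟩
    refine (measureReal_mono hsub (measure_ne_top μ _)).trans ((measureReal_biUnion_finset_le _ _).trans ?_)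
    refine Finset.sum_le_sum fun s _ => ?_
    split_ifs with h
    · rw [min_eq_right]
      simpa [hS] using h
    · rw [min_eq_left]
      have : ¬ μ.real (auxCell E s \ C) ≤ μ.real (auxCell E s ∩ C) := by simpa [hS] using h
      linarith

theorem aux_term {X : Type*} [MeasurableSpace X] (μ : Measure X) [IsProbabilityMeasure μ]
    {R : X → X} (hR : MeasurePreserving R μ μ) {A B U V : Set X} (hA : MeasurableSet A)
    (hB : MeasurableSet B) (hU : MeasurableSet U) (hV : MeasurableSet V) {δ : ℝ}
    (h1 : μ.real (symmDiff A U) ≤ δ) (h2 : μ.real (symmDiff B V) ≤ δ) :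
    |μ.real (A ∩ R ⁻¹' B) - μ.real A * μ.real B| ≤
      |μ.real (U ∩ R ⁻¹' V) - μ.real U * μ.real V| + 4 * δ := by
  have e1 := abs_measureReal_sub_le_measureReal_symmDiff (μ := μ) hA.nullMeasurableSet
    hU.nullMeasurableSet
  have e2 := abs_measureReal_sub_le_measureReal_symmDiff (μ := μ) hB.nullMeasurableSet
    hV.nullMeasurableSet
  have e3 := abs_measureReal_sub_le_measureReal_symmDiff (μ := μ)
    (hA.inter (hR.measurable hB)).nullMeasurableSet
    (hU.inter (hR.measurable hV)).nullMeasurableSet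
  have e4 : μ.real (symmDiff (A ∩ R ⁻¹' B) (U ∩ R ⁻¹' V)) ≤ 2 * δ := by
    have hs : symmDiff (A ∩ R ⁻¹' B) (U ∩ R ⁻¹' V) ⊆ symmDiff A U ∪ R ⁻¹' (symmDiff B V) := by
      intro x hx
      simp only [Set.mem_symmDiff, Set.mem_inter_iff, Set.mem_preimage, Set.mem_union] at hx ⊢
      tauto
    have h3 : μ.real (R ⁻¹' (symmDiff B V)) = μ.real (symmDiff B V) :=
      hR.measureReal_preimage (hB.symmDiff hV).nullMeasurableSet
    have h4 := measureReal_mono (μ := μ) hs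
    have h5 := measureReal_union_le (μ := μ) (symmDiff A U) (R ⁻¹' (symmDiff B V))
    linarith
  have e5 : |μ.real A * μ.real B - μ.real U * μ.real V| ≤ 2 * δ := by
    have : μ.real A * μ.real B - μ.real U * μ.real V =
      (μ.real A - μ.real U) * μ.real B + μ.real U * (μ.real B - μ.real V) := by ring
    rw [this]
    refine (abs_add_le _ _).trans ?_
    rw [abs_mul, abs_mul, abs_of_nonneg (measureReal_nonneg (μ := μ) (s := B)),
      abs_of_nonneg (measureReal_nonneg (μ := μ) (s := U))]
    have b1 := mul_le_mul_of_nonneg_left (measureReal_le_one (μ := μ) (s := B))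
      (abs_nonneg (μ.real A - μ.real U))
    have b2 := mul_le_mul_of_nonneg_right (measureReal_le_one (μ := μ) (s := U))
      (abs_nonneg (μ.real B - μ.real V))
    linarith
  have e6 := e3.trans e4
  rw [abs_le] at e5 e6
  have e7 := neg_abs_le (μ.real (U ∩ R ⁻¹' V) - μ.real U * μ.real V)
  have e8 := le_abs_self (μ.real (U ∩ R ⁻¹' V) - μ.real U * μ.real V)
  rw [abs_le]
  constructor <;> linarith [e5.1, e5.2, e6.1, e6.2]

/-- If `T` is weak mixing and `H_μ(𝒞) = 0`, then `T` is uniformly weak mixing on `𝒞`: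
`sup_{A,B ∈ 𝒞} (1/n) ∑_{i<n} |μ(A ∩ T⁻ⁱB) − μ(A)μ(B)| → 0`. -/
theorem uniform_weak_mixing_of_zero_entropy
    {X : Type*} [MeasurableSpace X] (μ : Measure X) [IsProbabilityMeasure μ]
    (T : X → X) (hT : MeasurePreserving T μ μ)
    (hmix : ∀ A B : Set X, MeasurableSet A → MeasurableSet B →
      Tendsto (fun n : ℕ =>
          (∑ i ∈ Finset.range n,
            |(μ (A ∩ (T^[i]) ⁻¹' B)).toReal - (μ A).toReal * (μ B).toReal|) / n)
        atTop (nhds 0))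
    (𝒞 : Set (Set X)) (h𝒞 : ∀ C ∈ 𝒞, MeasurableSet C) (hent : famEntropy μ 𝒞 = 0) :
    Tendsto
      (fun n : ℕ => ⨆ A : 𝒞, ⨆ B : 𝒞,
        (∑ i ∈ Finset.range n,
          |(μ ((A : Set X) ∩ (T^[i]) ⁻¹' (B : Set X))).toReal -
            (μ A).toReal * (μ B).toReal|) / n)
      atTop (nhds 0) := by
  have hnn : ∀ n : ℕ, 0 ≤ ⨆ A : 𝒞, ⨆ B : 𝒞,
        (∑ i ∈ Finset.range n,
          |(μ ((A : Set X) ∩ (T^[i]) ⁻¹' (B : Set X))).toReal -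
            (μ A).toReal * (μ B).toReal|) / n := fun n =>
    Real.iSup_nonneg fun A => Real.iSup_nonneg fun B =>
      div_nonneg (Finset.sum_nonneg fun i _ => abs_nonneg _) (Nat.cast_nonneg n)
  rw [Metric.tendsto_nhds]
  intro ε hε
  have hδ : 0 < ε / 6 := by positivity
  set δ := ε / 6 with hδ'
  obtain ⟨m, U, hU, hnet⟩ := aux_net μ 𝒞 h𝒞 hent hδ
  have hev : ∀ᶠ n : ℕ in atTop, ∀ S S', (∑ i ∈ Finset.range n,
            |(μ (U S ∩ (T^[i]) ⁻¹' U S')).toReal - (μ (U S)).toReal * (μ (U S')).toReal|) / n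
            < δ := by
    rw [eventually_all]
    intro S
    rw [eventually_all]
    intro S'
    exact (hmix (U S) (U S') (hU S) (hU S')).eventually_lt_const hδ
  filter_upwards [hev, eventually_gt_atTop 0] with n hn hn0
  rw [Real.dist_eq, sub_zero, abs_of_nonneg (hnn n)]
  have hn0' : (0 : ℝ) < n := by exact_mod_cast hn0
  refine lt_of_le_of_lt (b := 5 * δ) ?_ (by rw [hδ']; linarith)
  refine Real.iSup_le (fun A => Real.iSup_le (fun B => ?_) (by positivity)) (by positivity)
  obtain ⟨S, hS⟩ := hnet A A.2
  obtain ⟨S', hS'⟩ := hnet B B.2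
  have hsum : (∑ i ∈ Finset.range n,
          |(μ ((A : Set X) ∩ (T^[i]) ⁻¹' (B : Set X))).toReal -
            (μ A).toReal * (μ B).toReal|) ≤ ∑ i ∈ Finset.range n,
            (|(μ (U S ∩ (T^[i]) ⁻¹' U S')).toReal - (μ (U S)).toReal * (μ (U S')).toReal|
              + 4 * δ) :=
    Finset.sum_le_sum fun i _ =>
      aux_term μ (hT.iterate i) (h𝒞 _ A.2) (h𝒞 _ B.2) (hU S) (hU S') hS hS'
  rw [Finset.sum_add_distrib, Finset.sum_const, Finset.card_range, nsmul_eq_mul] at hsum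
  have h5 := hn S S'
  rw [div_lt_iff₀ hn0'] at h5
  rw [div_le_iff₀ hn0']
  linarith
end
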